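/- arXiv:1710.05233 — 13 statements merged into one kernel-verified Lean document; each statement's English description precedes it below -/
import Mathlib

section
/- Let Z = X × {0,1} be a finite example domain, let D be a probability distribution on Z, let m ∈ ℕ, and let S = (Z_1,…,Z_m) ~ D^m be an i.i.d. sample. Let h be a random variable taking values in hypotheses X → {0,1}, jointly distributed with S, such that the mutual information satisfies I(S; h) ≤ d (in bits). Then for every ε > 0 with 2mε² > 1, Pr[ |êrr(h; S) − err(h; D)| > ε ] ≤ (d + 1)/(2mε² − 1), where the probability is over the joint distribution of (S, h). -/
open scoped Classical

/-- Shannon entropy (in bits) of a distribution given by a weight function on a finite type. -/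
noncomputable def ent {α : Type*} [Fintype α] (p : α → ℝ) : ℝ :=
  - ∑ a, p a * Real.logb 2 (p a)

/-- Mutual information (in bits) between the two coordinates of a joint distribution
given by a weight function on a finite product type. -/
noncomputable def mutInfo {α β : Type*} [Fintype α] [Fintype β] (μ : α × β → ℝ) : ℝ :=
  ent (fun a => ∑ b, μ (a, b)) + ent (fun b => ∑ a, μ (a, b)) - ent μ

/-- True error of a hypothesis `h : X → Bool` with respect to a distribution `D` on
`X × Bool`. -/
noncomputable def trueErr {X : Type*} [Fintype X] (D : X × Bool → ℝ) (h : X → Bool) : ℝ :=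
  ∑ z, D z * (if h z.1 ≠ z.2 then (1 : ℝ) else 0)

/-- Empirical error of a hypothesis `h : X → Bool` on a sample `S` of size `m`. -/
noncomputable def empErr {X : Type*} {m : ℕ} (S : Fin m → X × Bool) (h : X → Bool) : ℝ :=
  (1 / (m : ℝ)) * ∑ i, (if h (S i).1 ≠ (S i).2 then (1 : ℝ) else 0)

open MeasureTheory ProbabilityTheory in
/-- Hoeffding's lemma for a `[0, 1]`-valued function on a finite probability space. -/
lemma sum_mul_exp_centered_le {Z : Type*} [Fintype Z] (D : Z → ℝ) (hD0 : ∀ z, 0 ≤ D z)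
    (hD1 : ∑ z, D z = 1) (l : Z → ℝ) (hl : ∀ z, l z ∈ Set.Icc (0 : ℝ) 1) (t : ℝ) :
    ∑ z, D z * Real.exp (t * (l z - ∑ w, D w * l w)) ≤ Real.exp (t ^ 2 / 8) := by
  let _ : MeasurableSpace Z := ⊤
  let P : Measure Z := ∑ z, ENNReal.ofReal (D z) • Measure.dirac z
  have hint : ∀ f : Z → ℝ, ∫ z, f z ∂P = ∑ z, D z * f z := by
    intro f
    rw [integral_finsetSum_measure]
    · refine Finset.sum_congr rfl fun z _ => ?_
      rw [integral_smul_measure, integral_dirac, ENNReal.toReal_ofReal (hD0 z), smul_eq_mul]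
    · intro z _
      exact (integrable_dirac (by simp)).smul_measure ENNReal.ofReal_ne_top
  have : IsProbabilityMeasure P := by
    constructor
    simp only [P, Measure.coe_finsetSum, Finset.sum_apply, Measure.smul_apply, measure_univ,
      smul_eq_mul, mul_one]
    rw [← ENNReal.ofReal_sum_of_nonneg fun z _ => hD0 z, hD1, ENNReal.ofReal_one]
  have h := (hasSubgaussianMGF_of_mem_Icc (μ := P) (X := l) (a := 0) (b := 1)
    (measurable_from_top.aemeasurable) (Filter.Eventually.of_forall hl)).mgf_le t
  rw [mgf, hint, hint] at h
  refine h.trans_eq ?_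
  congr 1
  simp
  ring

lemma sum_prod_apply_eq_pow {Z : Type*} [Fintype Z] (m : ℕ) (f : Z → ℝ) :
    ∑ s : Fin m → Z, ∏ i, f (s i) = (∑ z, f z) ^ m := by
  rw [← Fintype.piFinset_univ, Finset.sum_prod_piFinset]
  simp

/-- Chernoff form of Hoeffding's lemma for an i.i.d. sample of size `m`. -/
lemma sum_prod_mul_exp_le {Z : Type*} [Fintype Z] (m : ℕ) (D : Z → ℝ) (hD0 : ∀ z, 0 ≤ D z)
    (hD1 : ∑ z, D z = 1) (l : Z → ℝ) (hl : ∀ z, l z ∈ Set.Icc (0 : ℝ) 1) (t : ℝ) :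
    ∑ s : Fin m → Z, (∏ i, D (s i)) * Real.exp (t * ∑ i, (l (s i) - ∑ w, D w * l w))
      ≤ Real.exp (m * (t ^ 2 / 8)) := by
  have h : ∀ s : Fin m → Z,
      (∏ i, D (s i)) * Real.exp (t * ∑ i, (l (s i) - ∑ w, D w * l w))
        = ∏ i, (D (s i) * Real.exp (t * (l (s i) - ∑ w, D w * l w))) := by
    intro s
    rw [Finset.prod_mul_distrib, Finset.mul_sum, Real.exp_sum]
  simp_rw [h]
  rw [sum_prod_apply_eq_pow m fun z => D z * Real.exp (t * (l z - ∑ w, D w * l w)),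
    Real.exp_nat_mul]
  exact pow_le_pow_left₀
    (Finset.sum_nonneg fun z _ => mul_nonneg (hD0 z) (Real.exp_pos _).le)
    (sum_mul_exp_centered_le D hD0 hD1 l hl t) m

/-- Hoeffding's inequality for the empirical error of a fixed hypothesis. -/
lemma sum_prod_ite_lt_abs_empErr_sub_trueErr_le {X : Type*} [Fintype X] (m : ℕ) (hm : 0 < m)
    (D : X × Bool → ℝ) (hD0 : ∀ z, 0 ≤ D z) (hD1 : ∑ z, D z = 1) (h : X → Bool)
    (ε : ℝ) (hε : 0 < ε) :
    ∑ s : Fin m → X × Bool,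
        (∏ i, D (s i)) * (if ε < |empErr s h - trueErr D h| then (1 : ℝ) else 0)
      ≤ 2 * Real.exp (-(2 * m * ε ^ 2)) := by
  let l : X × Bool → ℝ := fun z => if h z.1 ≠ z.2 then (1 : ℝ) else 0
  have hl : ∀ z, l z ∈ Set.Icc (0 : ℝ) 1 := by
    intro z
    by_cases hz : h z.1 = z.2 <;> simp [l, hz]
  let T : (Fin m → X × Bool) → ℝ := fun s => ∑ i, (l (s i) - ∑ w, D w * l w)
  have hm' : (0 : ℝ) < m := Nat.cast_pos.mpr hm
  have hT : ∀ s, T s = m * (empErr s h - trueErr D h) := by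
    intro s
    simp only [T, empErr, trueErr, l, Finset.sum_sub_distrib, Finset.sum_const, Finset.card_univ,
      Fintype.card_fin, nsmul_eq_mul]
    field_simp
  have key : ∀ s, (if ε < |empErr s h - trueErr D h| then (1 : ℝ) else 0)
      ≤ Real.exp (-(4 * m * ε ^ 2)) *
        (Real.exp (4 * ε * T s) + Real.exp (-(4 * ε) * T s)) := by
    intro s
    rw [mul_add, ← Real.exp_add, ← Real.exp_add]
    split_ifs with hs
    · have hc : 0 < 4 * ε * m := by positivity
      rcases lt_abs.mp hs with h1 | h1
      · have := Real.one_le_exp (x := -(4 * m * ε ^ 2) + 4 * ε * T s) (by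
          rw [hT]; nlinarith [mul_lt_mul_of_pos_left h1 hc])
        linarith [Real.exp_pos (-(4 * m * ε ^ 2) + -(4 * ε) * T s)]
      · have := Real.one_le_exp (x := -(4 * m * ε ^ 2) + -(4 * ε) * T s) (by
          rw [hT]; nlinarith [mul_lt_mul_of_pos_left h1 hc])
        linarith [Real.exp_pos (-(4 * m * ε ^ 2) + 4 * ε * T s)]
    · positivity
  calc _ ≤ ∑ s : Fin m → X × Bool, (∏ i, D (s i)) * (Real.exp (-(4 * m * ε ^ 2)) *
        (Real.exp (4 * ε * T s) + Real.exp (-(4 * ε) * T s))) :=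
        Finset.sum_le_sum fun s _ =>
          mul_le_mul_of_nonneg_left (key s) (Finset.prod_nonneg fun i _ => hD0 _)
    _ = Real.exp (-(4 * m * ε ^ 2)) *
        (∑ s : Fin m → X × Bool, (∏ i, D (s i)) * Real.exp (4 * ε * T s) +
          ∑ s : Fin m → X × Bool, (∏ i, D (s i)) * Real.exp (-(4 * ε) * T s)) := by
        rw [← Finset.sum_add_distrib, Finset.mul_sum]
        exact Finset.sum_congr rfl fun s _ => by ring
    _ ≤ Real.exp (-(4 * m * ε ^ 2)) *
        (Real.exp (m * ((4 * ε) ^ 2 / 8)) + Real.exp (m * ((-(4 * ε)) ^ 2 / 8))) :=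
        mul_le_mul_of_nonneg_left
          (add_le_add (sum_prod_mul_exp_le m D hD0 hD1 l hl _)
            (sum_prod_mul_exp_le m D hD0 hD1 l hl _)) (Real.exp_pos _).le
    _ = 2 * Real.exp (-(2 * m * ε ^ 2)) := by
        rw [mul_add, ← Real.exp_add, ← Real.exp_add]
        ring_nf

lemma mutInfo_eq_sum {α β : Type*} [Fintype α] [Fintype β] (μ : α × β → ℝ) :
    mutInfo μ = ∑ p, μ p * (Real.logb 2 (μ p) - Real.logb 2 (∑ b, μ (p.1, b))
      - Real.logb 2 (∑ a, μ (a, p.2))) := by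
  simp only [mutInfo, ent, mul_sub, Finset.sum_sub_distrib]
  have h1 : ∑ p : α × β, μ p * Real.logb 2 (∑ b, μ (p.1, b))
      = ∑ a, (∑ b, μ (a, b)) * Real.logb 2 (∑ b, μ (a, b)) := by
    simp_rw [Fintype.sum_prod_type, Finset.sum_mul]
  have h2 : ∑ p : α × β, μ p * Real.logb 2 (∑ a, μ (a, p.2))
      = ∑ b, (∑ a, μ (a, b)) * Real.logb 2 (∑ a, μ (a, b)) := by
    simp_rw [Fintype.sum_prod_type_right, Finset.sum_mul]
  rw [h1, h2]
  ring

/-- A form of the Donsker–Varadhan inequality: a change of measure from the joint distribution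
to the product of its marginals. -/
lemma sum_mul_le_mutInfo_add_one {α β : Type*} [Fintype α] [Fintype β] (μ : α × β → ℝ)
    (hμ0 : ∀ p, 0 ≤ μ p) (hμ1 : ∑ p, μ p = 1) (f : α × β → ℝ)
    (hf : ∑ p : α × β, (∑ b, μ (p.1, b)) * (∑ a, μ (a, p.2)) * (2 : ℝ) ^ f p ≤ 2) :
    ∑ p, μ p * f p ≤ mutInfo μ + 1 := by
  have hlog : 0 < Real.log 2 := Real.log_pos one_lt_two
  have key : ∀ p : α × β,
      Real.log 2 * (μ p * f p - μ p * (Real.logb 2 (μ p) - Real.logb 2 (∑ b, μ (p.1, b))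
        - Real.logb 2 (∑ a, μ (a, p.2))) - μ p)
      ≤ (∑ b, μ (p.1, b)) * (∑ a, μ (a, p.2)) * (2 : ℝ) ^ f p / 2 - μ p := by
    rintro ⟨a, b⟩
    have hP : μ (a, b) ≤ ∑ b, μ (a, b) :=
      Finset.single_le_sum (f := fun b => μ (a, b)) (fun b _ => hμ0 (a, b)) (Finset.mem_univ b)
    have hQ : μ (a, b) ≤ ∑ a, μ (a, b) :=
      Finset.single_le_sum (f := fun a => μ (a, b)) (fun a _ => hμ0 (a, b)) (Finset.mem_univ a)
    dsimp only
    generalize (∑ b, μ (a, b)) = P at hP ⊢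
    generalize (∑ a, μ (a, b)) = Q at hQ ⊢
    generalize f (a, b) = c
    have h0 := hμ0 (a, b)
    generalize μ (a, b) = x at *
    have h2 : (0 : ℝ) < 2 ^ c := Real.rpow_pos_of_pos two_pos c
    rcases h0.eq_or_lt with rfl | hx
    · simp only [zero_mul, sub_zero, mul_zero]
      positivity
    · have hP' := hx.trans_le hP
      have hQ' := hx.trans_le hQ
      have hle := Real.log_le_sub_one_of_pos (x := P * Q * 2 ^ c / (2 * x)) (by positivity)
      rw [Real.log_div (by positivity) (by positivity), Real.log_mul (by positivity) h2.ne',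
        Real.log_mul hP'.ne' hQ'.ne', Real.log_rpow two_pos,
        Real.log_mul two_ne_zero hx.ne'] at hle
      have hmul := mul_le_mul_of_nonneg_left hle hx.le
      have e1 : x * (P * Q * 2 ^ c / (2 * x) - 1) = P * Q * 2 ^ c / 2 - x := by
        field_simp
      rw [e1] at hmul
      refine le_trans (le_of_eq ?_) hmul
      simp only [Real.logb]
      field_simp
      ring
  have hsum := Finset.sum_le_sum fun p (_ : p ∈ Finset.univ) => key p
  rw [← Finset.mul_sum, Finset.sum_sub_distrib, Finset.sum_sub_distrib, ← mutInfo_eq_sum,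
    Finset.sum_sub_distrib, hμ1, ← Finset.sum_div] at hsum
  by_contra! hlt
  nlinarith [mul_pos hlog (sub_pos.mpr hlt)]

/-- If the joint distribution `μ` of (sample `S`, hypothesis `h`) has
sample-marginal `D^m` and mutual information at most `d` bits, then for every `ε > 0`
with `2mε² > 1`, the probability that the empirical and true errors differ by more than
`ε` is at most `(d+1)/(2mε² − 1)`. -/
theorem stmt0 {X : Type*} [Fintype X] [DecidableEq X] (m : ℕ) (d : ℝ)
    (D : X × Bool → ℝ) (hD0 : ∀ z, 0 ≤ D z) (hD1 : ∑ z, D z = 1)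
    (μ : (Fin m → X × Bool) × (X → Bool) → ℝ)
    (hμ0 : ∀ p, 0 ≤ μ p) (hμ1 : ∑ p, μ p = 1)
    (hmarg : ∀ s, (∑ h, μ (s, h)) = ∏ i, D (s i))
    (hI : mutInfo μ ≤ d)
    (ε : ℝ) (hε : 0 < ε) (hmε : 1 < 2 * m * ε ^ 2) :
    ∑ p ∈ Finset.univ.filter
        (fun p : (Fin m → X × Bool) × (X → Bool) =>
          ε < |empErr p.1 p.2 - trueErr D p.2|), μ p
      ≤ (d + 1) / (2 * m * ε ^ 2 - 1) := by
  have hm : 0 < m := by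
    rcases Nat.eq_zero_or_pos m with rfl | hm
    · norm_num at hmε
    · exact hm
  set t : ℝ := 2 * m * ε ^ 2 - 1 with ht
  have ht0 : 0 < t := by linarith
  let B : (Fin m → X × Bool) × (X → Bool) → Prop :=
    fun p => ε < |empErr p.1 p.2 - trueErr D p.2|
  let f : (Fin m → X × Bool) × (X → Bool) → ℝ := fun p => if B p then t else 0
  have hexp : (2 : ℝ) ^ t * (2 * Real.exp (-(2 * m * ε ^ 2))) ≤ 1 := by
    have e : (2 : ℝ) ^ t * 2 = 2 ^ (t + 1) := by
      rw [Real.rpow_add two_pos, Real.rpow_one]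
    rw [← mul_assoc, e, Real.rpow_def_of_pos two_pos, ← Real.exp_add, Real.exp_le_one_iff]
    have : Real.log 2 ≤ 1 := by linarith [Real.log_two_lt_d9]
    nlinarith
  have hprod : ∑ s : Fin m → X × Bool, ∏ i, D (s i) = 1 := by
    rw [sum_prod_apply_eq_pow, hD1, one_pow]
  have hmgf : ∀ h, ∑ s : Fin m → X × Bool, (∏ i, D (s i)) * (2 : ℝ) ^ f (s, h) ≤ 2 := by
    intro h
    have hpt : ∀ s : Fin m → X × Bool, (∏ i, D (s i)) * (2 : ℝ) ^ f (s, h) ≤ (∏ i, D (s i)) +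
        (2 : ℝ) ^ t * ((∏ i, D (s i)) *
          (if ε < |empErr s h - trueErr D h| then (1 : ℝ) else 0)) := by
      intro s
      have hs : 0 ≤ ∏ i, D (s i) := Finset.prod_nonneg fun i _ => hD0 _
      by_cases hb : ε < |empErr s h - trueErr D h|
      · simp only [f, B, hb, if_true]
        linarith
      · simp [f, B, hb]
    refine (Finset.sum_le_sum fun s _ => hpt s).trans ?_
    rw [Finset.sum_add_distrib, hprod, ← Finset.mul_sum]
    linarith [mul_le_mul_of_nonneg_left
      (sum_prod_ite_lt_abs_empErr_sub_trueErr_le m hm D hD0 hD1 h ε hε)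
      (Real.rpow_pos_of_pos two_pos t).le]
  have hdv := sum_mul_le_mutInfo_add_one μ hμ0 hμ1 f (by
    rw [Fintype.sum_prod_type_right]
    have hrow : ∀ h, ∑ s : Fin m → X × Bool,
        (∑ b, μ (s, b)) * (∑ a, μ (a, h)) * (2 : ℝ) ^ f (s, h) ≤ (∑ a, μ (a, h)) * 2 := by
      intro h
      refine le_trans (le_of_eq ?_)
        (mul_le_mul_of_nonneg_left (hmgf h) (Finset.sum_nonneg fun a _ => hμ0 (a, h)))
      rw [Finset.mul_sum]
      refine Finset.sum_congr rfl fun s _ => ?_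
      rw [hmarg]
      ring
    refine (Finset.sum_le_sum fun h _ => hrow h).trans_eq ?_
    rw [← Finset.sum_mul, ← Fintype.sum_prod_type_right, hμ1, one_mul])
  rw [le_div_iff₀ ht0]
  calc _ = ∑ p, μ p * f p := by
        rw [Finset.sum_filter, Finset.sum_mul]
        refine Finset.sum_congr rfl fun p _ => ?_
        by_cases hb : ε < |empErr p.1 p.2 - trueErr D p.2| <;> simp [f, B, hb]
    _ ≤ d + 1 := by linarith
end

section
/- Let μ and ν be probability distributions on a finite set X and let E ⊆ X satisfy 0 < ν(E) < 1. Then μ(E) ≤ (KL(μ‖ν) + 1)/log₂(1/ν(E)), where KL(μ‖ν) = Σ_x μ(x) log₂(μ(x)/ν(x)) is the Kullback–Leibler divergence in bits (with the convention 0·log₂(0/0) = 0). -/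
open scoped Classical

/-- Kullback–Leibler divergence in bits, valued in the extended reals: terms with
`μ x = 0` contribute `0`; terms with `μ x > 0` and `ν x = 0` contribute `⊤`. -/
noncomputable def klE {X : Type*} [Fintype X] (μ ν : X → ℝ) : EReal :=
  ∑ x, (if μ x = 0 then (0 : EReal)
        else if ν x = 0 then (⊤ : EReal)
        else ((μ x * Real.logb 2 (μ x / ν x) : ℝ) : EReal))

/-- Tangent-line lower bound for a single summand of the divergence. -/
lemma mul_logb_add_le_mul_logb_div {m n t : ℝ} (hm : 0 < m) (hn : 0 < n) (ht : 0 < t) :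
    m * Real.logb 2 t + (m - n * t) / Real.log 2 ≤ m * Real.logb 2 (m / n) := by
  have h2 : 0 < Real.log 2 := Real.log_pos one_lt_two
  have h := mul_le_mul_of_nonneg_left
    (Real.log_le_sub_one_of_pos (show 0 < n * t / m by positivity)) hm.le
  rw [Real.log_div (by positivity) hm.ne', Real.log_mul hn.ne' ht.ne', mul_sub m (n * t / m) 1,
    mul_div_cancel₀ _ hm.ne'] at h
  rw [Real.logb, Real.logb, Real.log_div hm.ne' hn.ne', mul_div_assoc', mul_div_assoc',
    ← add_div, div_le_div_iff_of_pos_right h2]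
  linarith

/-- Variational lower bound for the divergence, with a positive test function `t`. -/
lemma coe_sum_le_klE {X : Type*} [Fintype X] (μ ν t : X → ℝ)
    (hμ0 : ∀ x, 0 ≤ μ x) (hν0 : ∀ x, 0 ≤ ν x) (ht : ∀ x, 0 < t x) :
    ((∑ x, (μ x * Real.logb 2 (t x) + (μ x - ν x * t x) / Real.log 2) : ℝ) : EReal)
      ≤ klE μ ν := by
  have h2 : 0 < Real.log 2 := Real.log_pos one_lt_two
  let coeHom : ℝ →+ EReal := ⟨⟨Real.toEReal, EReal.coe_zero⟩, EReal.coe_add⟩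
  change coeHom _ ≤ _
  rw [klE, map_sum]
  refine Finset.sum_le_sum fun x _ => ?_
  split_ifs with hm hn
  · change ((_ : ℝ) : EReal) ≤ ((0 : ℝ) : EReal)
    rw [EReal.coe_le_coe_iff, hm, zero_mul, zero_add, zero_sub]
    exact div_nonpos_of_nonpos_of_nonneg
      (neg_nonpos.mpr (mul_nonneg (hν0 x) (ht x).le)) h2.le
  · exact le_top
  · exact EReal.coe_le_coe_iff.mpr (mul_logb_add_le_mul_logb_div
      ((hμ0 x).lt_of_ne' hm) ((hν0 x).lt_of_ne' hn) (ht x))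

/-- For probability distributions `μ, ν` on a finite set and an event `E`
with `0 < ν(E) < 1`, one has `μ(E) ≤ (KL(μ‖ν) + 1) / log₂(1/ν(E))`. -/
theorem stmt1 {X : Type*} [Fintype X] (μ ν : X → ℝ)
    (hμ0 : ∀ x, 0 ≤ μ x) (hμ1 : ∑ x, μ x = 1)
    (hν0 : ∀ x, 0 ≤ ν x) (hν1 : ∑ x, ν x = 1)
    (E : Finset X) (hE0 : 0 < ∑ x ∈ E, ν x) (hE1 : ∑ x ∈ E, ν x < 1) :
    ((∑ x ∈ E, μ x : ℝ) : EReal) ≤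
      (klE μ ν + 1) / ((Real.logb 2 (1 / ∑ x ∈ E, ν x) : ℝ) : EReal) := by
  set q := ∑ x ∈ E, ν x with hq
  have hL : 0 < Real.logb 2 (1 / q) :=
    Real.logb_pos one_lt_two ((one_lt_div hE0).mpr hE1)
  have hZ : 0 < 2 - q := by linarith
  rw [EReal.le_div_iff_mul_le (by exact_mod_cast hL) (EReal.coe_ne_top _), ← EReal.coe_mul]
  let t : X → ℝ := fun x => (if x ∈ E then 1 / q else 1) / (2 - q)
  have ht : ∀ x, 0 < t x := fun x => by
    dsimp only [t]
    split_ifs <;> positivity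
  have hlog : ∀ x, μ x * Real.logb 2 (t x) =
      (if x ∈ E then μ x else 0) * Real.logb 2 (1 / q) - μ x * Real.logb 2 (2 - q) := fun x => by
    dsimp only [t]
    split_ifs
    · rw [Real.logb_div (by positivity) hZ.ne']
      ring
    · rw [Real.logb_div one_ne_zero hZ.ne', Real.logb_one]
      ring
  have hνt : ∀ x, ν x * t x =
      ((if x ∈ E then ν x else 0) * (1 / q - 1) + ν x) / (2 - q) := fun x => by
    dsimp only [t]
    split_ifs <;> ring
  have hsum : ∑ x, ν x * t x = 1 := by
    simp_rw [hνt]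
    rw [← Finset.sum_div, Finset.sum_add_distrib, ← Finset.sum_mul, hν1,
      Finset.sum_ite_mem, Finset.univ_inter, ← hq]
    field_simp
    ring
  have hbound : (∑ x ∈ E, μ x) * Real.logb 2 (1 / q) - Real.logb 2 (2 - q) =
      ∑ x, (μ x * Real.logb 2 (t x) + (μ x - ν x * t x) / Real.log 2) := by
    rw [Finset.sum_add_distrib, ← Finset.sum_div, Finset.sum_sub_distrib, hsum, hμ1]
    simp_rw [hlog]
    rw [Finset.sum_sub_distrib, ← Finset.sum_mul, ← Finset.sum_mul, hμ1,
      Finset.sum_ite_mem, Finset.univ_inter]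
    ring
  have hone : Real.logb 2 (2 - q) ≤ 1 := by
    rw [Real.logb_le_iff_le_rpow one_lt_two hZ, Real.rpow_one]
    linarith
  calc (((∑ x ∈ E, μ x) * Real.logb 2 (1 / q) : ℝ) : EReal)
      ≤ (((∑ x ∈ E, μ x) * Real.logb 2 (1 / q) - Real.logb 2 (2 - q) + 1 : ℝ) : EReal) :=
        EReal.coe_le_coe_iff.mpr (by linarith)
    _ ≤ klE μ ν + 1 := by
        rw [EReal.coe_add, hbound, EReal.coe_one]
        gcongr
        exact coe_sum_le_klE μ ν t hμ0 hν0 ht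
end

section
/- Let (X, Y) be a pair of random variables taking values in a finite product space 𝒳 × 𝒴 with joint distribution μ, and let E ⊆ 𝒳 × 𝒴 be an event. Suppose there is 0 < α < 1 such that for every y ∈ 𝒴, μ_X(E_y) ≤ α, where μ_X is the marginal distribution of X and E_y = {x : (x,y) ∈ E} is the fiber of E over y. Then μ(E) ≤ (I(X;Y) + 1)/log₂(1/α). -/
open scoped Classical

/-- Entropy in nats. -/
lemma ent_mul_log_two {γ : Type*} [Fintype γ] (p : γ → ℝ) :
    ent p * Real.log 2 = -∑ c, p c * Real.log (p c) := by
  have hlog : Real.log 2 ≠ 0 := (Real.log_pos one_lt_two).ne'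
  rw [ent, neg_mul, Finset.sum_mul]
  congr 1
  refine Finset.sum_congr rfl fun c _ => ?_
  rw [Real.logb, mul_assoc, div_mul_cancel₀ _ hlog]

/-- Mutual information in nats as the relative entropy of the joint distribution with respect
to the product of its marginals. -/
lemma mutInfo_mul_log_two {α β : Type*} [Fintype α] [Fintype β] (μ : α × β → ℝ) :
    mutInfo μ * Real.log 2 = ∑ p : α × β, μ p * (Real.log (μ p)
      - Real.log (∑ b, μ (p.1, b)) - Real.log (∑ a, μ (a, p.2))) := by
  simp only [mutInfo, sub_mul, add_mul, ent_mul_log_two, mul_sub, Finset.sum_sub_distrib]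
  have hX : ∑ p : α × β, μ p * Real.log (∑ b, μ (p.1, b))
      = ∑ a, (∑ b, μ (a, b)) * Real.log (∑ b, μ (a, b)) := by
    simp only [Fintype.sum_prod_type, Finset.sum_mul]
  have hY : ∑ p : α × β, μ p * Real.log (∑ a, μ (a, p.2))
      = ∑ b, (∑ a, μ (a, b)) * Real.log (∑ a, μ (a, b)) := by
    simp only [Fintype.sum_prod_type_right, Finset.sum_mul]
  rw [hX, hY]
  ring

/-- The pointwise inequality behind the nonnegativity of relative entropy. -/
lemma sub_le_mul_log_sub_log {p r : ℝ} (hp : 0 ≤ p) (hr : 0 ≤ r) (hpr : 0 < p → 0 < r) :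
    p - r ≤ p * (Real.log p - Real.log r) := by
  rcases hp.eq_or_lt with rfl | hp
  · simpa using hr
  · have hr := hpr hp
    have h := mul_le_mul_of_nonneg_left (Real.log_le_sub_one_of_pos (div_pos hr hp)) hp.le
    rw [Real.log_div hr.ne' hp.ne', mul_sub, mul_sub, mul_div_cancel₀ _ hp.ne'] at h
    linarith

/-- The product of the marginals gives `E` mass at most `α` if it does so on every fiber. -/
lemma sum_marginal_mul_marginal_le {𝒳 𝒴 : Type*} [Fintype 𝒳] [Fintype 𝒴]
    (μ : 𝒳 × 𝒴 → ℝ) (hμ0 : ∀ p, 0 ≤ μ p) (hμ1 : ∑ p, μ p = 1) (E : Set (𝒳 × 𝒴)) (α : ℝ)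
    (hfib : ∀ y : 𝒴,
      ∑ x ∈ Finset.univ.filter (fun x : 𝒳 => (x, y) ∈ E), (∑ y', μ (x, y')) ≤ α) :
    ∑ p ∈ Finset.univ.filter (fun p : 𝒳 × 𝒴 => p ∈ E),
      (∑ y, μ (p.1, y)) * (∑ x, μ (x, p.2)) ≤ α := by
  rw [Finset.sum_filter, Fintype.sum_prod_type_right]
  calc ∑ y, ∑ x, (if (x, y) ∈ E then (∑ y', μ (x, y')) * (∑ x', μ (x', y)) else 0)
      = ∑ y, (∑ x ∈ Finset.univ.filter (fun x : 𝒳 => (x, y) ∈ E), (∑ y', μ (x, y')))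
          * (∑ x', μ (x', y)) := by
        refine Finset.sum_congr rfl fun y _ => ?_
        rw [Finset.sum_mul, Finset.sum_filter]
    _ ≤ ∑ y, α * (∑ x', μ (x', y)) :=
        Finset.sum_le_sum fun y _ =>
          mul_le_mul_of_nonneg_right (hfib y) (Finset.sum_nonneg fun x _ => hμ0 _)
    _ = α := by rw [← Finset.mul_sum, ← Fintype.sum_prod_type_right, hμ1, mul_one]

/-- If every fiber `E_y` of the event `E` has `μ_X`-measure at most
`α ∈ (0,1)`, then `μ(E) ≤ (I(X;Y) + 1)/log₂(1/α)`. -/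
theorem stmt2 {𝒳 𝒴 : Type*} [Fintype 𝒳] [Fintype 𝒴]
    (μ : 𝒳 × 𝒴 → ℝ) (hμ0 : ∀ p, 0 ≤ μ p) (hμ1 : ∑ p, μ p = 1)
    (E : Set (𝒳 × 𝒴)) (α : ℝ) (hα0 : 0 < α) (hα1 : α < 1)
    (hfib : ∀ y : 𝒴,
      ∑ x ∈ Finset.univ.filter (fun x : 𝒳 => (x, y) ∈ E), (∑ y', μ (x, y')) ≤ α) :
    ∑ p ∈ Finset.univ.filter (fun p : 𝒳 × 𝒴 => p ∈ E), μ p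
      ≤ (mutInfo μ + 1) / Real.logb 2 (1 / α) := by
  set P : 𝒳 → ℝ := fun x => ∑ y, μ (x, y)
  set Q : 𝒴 → ℝ := fun y => ∑ x, μ (x, y)
  have hP0 (x : 𝒳) : 0 ≤ P x := Finset.sum_nonneg fun y _ => hμ0 _
  have hQ0 (y : 𝒴) : 0 ≤ Q y := Finset.sum_nonneg fun x _ => hμ0 _
  have hP (p : 𝒳 × 𝒴) : μ p ≤ P p.1 :=
    Finset.single_le_sum (f := fun y => μ (p.1, y)) (fun y _ => hμ0 _) (Finset.mem_univ p.2)
  have hQ (p : 𝒳 × 𝒴) : μ p ≤ Q p.2 :=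
    Finset.single_le_sum (f := fun x => μ (x, p.2)) (fun x _ => hμ0 _) (Finset.mem_univ p.1)
  have hPQ : ∑ p : 𝒳 × 𝒴, P p.1 * Q p.2 = 1 := by
    have hP1 : ∑ x, P x = 1 := by rw [← hμ1, Fintype.sum_prod_type]
    have hQ1 : ∑ y, Q y = 1 := by rw [← hμ1, Fintype.sum_prod_type_right]
    rw [Fintype.sum_prod_type, ← Fintype.sum_mul_sum, hP1, hQ1, one_mul]
  have hE := sum_marginal_mul_marginal_le μ hμ0 hμ1 E α hfib
  have hlogα : Real.log α < 0 := Real.log_neg hα0 hα1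
  have hlog2 : 0 < Real.log 2 := Real.log_pos one_lt_two
  -- Gibbs' inequality against the product of the marginals, reweighted by `1 / α` on `E`
  let w : 𝒳 × 𝒴 → ℝ := fun p => if p ∈ E then α⁻¹ else 1
  have hw (p : 𝒳 × 𝒴) : 0 < w p := by
    dsimp only [w]; split_ifs <;> positivity
  have hsum : ∑ p : 𝒳 × 𝒴, P p.1 * Q p.2 * w p / 2 ≤ 1 := by
    have hle (p : 𝒳 × 𝒴) : P p.1 * Q p.2 * w p
        ≤ P p.1 * Q p.2 + α⁻¹ * (if p ∈ E then P p.1 * Q p.2 else 0) := by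
      have := mul_nonneg (hP0 p.1) (hQ0 p.2)
      dsimp only [w]
      split_ifs <;> linarith
    have h := Finset.sum_le_sum fun p (_ : p ∈ Finset.univ) => hle p
    rw [Finset.sum_add_distrib, ← Finset.mul_sum, ← Finset.sum_filter, hPQ] at h
    have h' := mul_le_mul_of_nonneg_left hE (inv_nonneg.2 hα0.le)
    rw [inv_mul_cancel₀ hα0.ne'] at h'
    rw [← Finset.sum_div]
    linarith
  have hgibbs (p : 𝒳 × 𝒴) : μ p - P p.1 * Q p.2 * w p / 2
      ≤ μ p * (Real.log (μ p) - Real.log (P p.1) - Real.log (Q p.2))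
        + Real.log α * (if p ∈ E then μ p else 0) + μ p * Real.log 2 := by
    have hPp := hP0 p.1
    have hQp := hQ0 p.2
    have hwp := hw p
    rcases (hμ0 p).eq_or_lt with h0 | hpos
    · have : 0 ≤ P p.1 * Q p.2 * w p / 2 := by positivity
      simpa [← h0] using this
    · have hPpos := hpos.trans_le (hP p)
      have hQpos := hpos.trans_le (hQ p)
      have h := sub_le_mul_log_sub_log (r := P p.1 * Q p.2 * w p / 2) hpos.le
        (by positivity) (fun _ => by positivity)
      rw [Real.log_div (by positivity) two_ne_zero, Real.log_mul (by positivity) hwp.ne',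
        Real.log_mul hPpos.ne' hQpos.ne'] at h
      refine h.trans_eq ?_
      dsimp only [w]
      split_ifs
      · rw [Real.log_inv]; ring
      · rw [Real.log_one]; ring
  have h := Finset.sum_le_sum fun p (_ : p ∈ Finset.univ) => hgibbs p
  rw [Finset.sum_sub_distrib, Finset.sum_add_distrib, Finset.sum_add_distrib,
    ← mutInfo_mul_log_two, ← Finset.mul_sum, ← Finset.sum_filter, ← Finset.sum_mul, hμ1] at h
  rw [Real.logb, one_div, Real.log_inv, le_div_iff₀ (div_pos (neg_pos.2 hlogα) hlog2), mul_div_assoc',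
    div_le_iff₀ hlog2]
  linarith
end

section
/- For every integer m ≥ 4 there exists n₀ such that for every n ≥ n₀ the following holds: there exist an integer M with 2^m/m ≤ M ≤ 8·2^m/m and subsets T_1,…,T_M of [n] = {1,…,n}, each of size at most n/2, such that 1/m ≤ |⋃_{i=1}^M T_i^m| / n^m ≤ 4/m, where T_i^m ⊆ [n]^m denotes the m-fold Cartesian power of T_i. -/
open scoped Classical

/-- If every point of `X` is related to at least a `1/Q` fraction of `S`, then some element of `S`
is related to at least a `1/Q` fraction of any prescribed finite set of points. -/
theorem exists_card_le_mul_card_filter {X S : Type*} [Fintype S] [Nonempty S]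
    (R : X → S → Prop) (Q : ℕ)
    (h : ∀ x, Fintype.card S ≤ Q * (Finset.univ.filter fun s => R x s).card) (U : Finset X) :
    ∃ s, U.card ≤ Q * (U.filter fun x => R x s).card := by
  by_contra! hlt
  have h₁ : ∑ s : S, Q * (U.filter fun x => R x s).card < ∑ _s : S, U.card :=
    Finset.sum_lt_sum_of_nonempty Finset.univ_nonempty fun s _ => hlt s
  have h₂ : ∑ _x ∈ U, Fintype.card S
      ≤ ∑ x ∈ U, Q * (Finset.univ.filter fun s => R x s).card :=
    Finset.sum_le_sum fun x _ => h x
  have h₃ : ∑ x ∈ U, (Finset.univ.filter fun s => R x s).card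
      = ∑ s : S, (U.filter fun x => R x s).card :=
    Finset.sum_card_bipartiteAbove_eq_sum_card_bipartiteBelow R
  rw [← Finset.mul_sum] at h₁ h₂
  rw [h₃] at h₂
  simp only [Finset.sum_const, smul_eq_mul, Finset.card_univ] at h₁ h₂
  rw [mul_comm] at h₂
  omega

/-- Greedy covering: `M` elements of `S` can be chosen such that all but a `(1 - 1/Q)^M` fraction
of the points is related to one of them. -/
theorem exists_card_uncovered_le {X S : Type*} [Fintype X] [Fintype S] [Nonempty S]
    (R : X → S → Prop) {Q : ℕ} (hQ : 1 ≤ Q)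
    (h : ∀ x, Fintype.card S ≤ Q * (Finset.univ.filter fun s => R x s).card) (M : ℕ) :
    ∃ t : Fin M → S, ((Finset.univ.filter fun x => ∀ i, ¬ R x (t i)).card : ℝ)
      ≤ (1 - 1 / (Q : ℝ)) ^ M * Fintype.card X := by
  have hQ' : (1 : ℝ) ≤ Q := by exact_mod_cast hQ
  induction M with
  | zero => exact ⟨Fin.elim0, by simp⟩
  | succ M ih =>
    obtain ⟨t, ht⟩ := ih
    obtain ⟨s, hs⟩ := exists_card_le_mul_card_filter R Q h
      (Finset.univ.filter fun x => ∀ i, ¬ R x (t i))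
    refine ⟨Fin.cons s t, ?_⟩
    have hsplit := Finset.card_filter_add_card_filter_not (fun x => R x s)
      (s := Finset.univ.filter fun x => ∀ i, ¬ R x (t i))
    have heq : (Finset.univ.filter fun x => ∀ i, ¬ R x ((Fin.cons s t : Fin (M + 1) → S) i))
        = (Finset.univ.filter fun x => ∀ i, ¬ R x (t i)).filter fun x => ¬ R x s := by
      ext x
      simp [Fin.forall_fin_succ, and_comm]
    rw [heq]
    set u := (Finset.univ.filter fun x => ∀ i, ¬ R x (t i)).card
    set a := ((Finset.univ.filter fun x => ∀ i, ¬ R x (t i)).filter fun x => R x s).card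
    set b := ((Finset.univ.filter fun x => ∀ i, ¬ R x (t i)).filter fun x => ¬ R x s).card
    have hs' : (u : ℝ) ≤ Q * a := by exact_mod_cast hs
    have hsplit' : (a : ℝ) + b = u := by exact_mod_cast hsplit
    have hua : (u : ℝ) / Q ≤ a := by
      rw [div_le_iff₀ (by linarith)]
      linarith
    have hnonneg : 0 ≤ 1 - 1 / (Q : ℝ) := by
      rw [sub_nonneg, div_le_one (by linarith)]
      exact hQ'
    calc (b : ℝ) = u - a := by linarith
      _ ≤ u - u / Q := by linarith
      _ = (1 - 1 / (Q : ℝ)) * u := by ring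
      _ ≤ (1 - 1 / (Q : ℝ)) * ((1 - 1 / (Q : ℝ)) ^ M * Fintype.card X) := by gcongr
      _ = _ := by ring

theorem one_sub_pow_le_inv_one_add_mul {p : ℝ} (hp₀ : 0 ≤ p) (hp₁ : p ≤ 1) (M : ℕ) :
    (1 - p) ^ M ≤ 1 / (1 + M * p) := by
  have hb : 1 + M * p ≤ (1 + p) ^ M := one_add_mul_le_pow (by linarith) M
  rw [le_div_iff₀ (by positivity)]
  calc (1 - p) ^ M * (1 + M * p) ≤ (1 - p) ^ M * (1 + p) ^ M :=
        mul_le_mul_of_nonneg_left hb (pow_nonneg (by linarith) M)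
    _ = (1 - p ^ 2) ^ M := by rw [← mul_pow]; ring
    _ ≤ 1 := pow_le_one₀ (by nlinarith) (by nlinarith)

/-- A prescribed restriction along an embedding of a size-`m` type is attained by at least a
`2⁻ᵐ` fraction of all Boolean functions. -/
theorem card_bool_fun_le_mul_card_restrict_eq {m k : ℕ} (e : Fin m ↪ Fin k) (b : Fin m → Bool) :
    Fintype.card (Fin k → Bool)
      ≤ 2 ^ m * (Finset.univ.filter fun s : Fin k → Bool => ∀ j, s (e j) = b j).card := by
  have hcard : (2 ^ m : ℕ) = (Finset.univ : Finset (Fin m → Bool)).card := by simp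
  rw [hcard, ← Finset.card_product, ← Finset.card_univ]
  refine Finset.card_le_card_of_injOn (fun s => (s ∘ e, Function.extend e b s)) ?_ ?_
  · intro s _
    simp [e.injective.extend_apply]
  · intro s _ s' _ hss
    simp only [Prod.mk.injEq] at hss
    funext i
    by_cases hi : ∃ j, e j = i
    · obtain ⟨j, rfl⟩ := hi
      exact congrFun hss.1 j
    · simpa [Function.extend_apply' _ _ _ hi] using congrFun hss.2 i

/-- The element of the `i`-th pair `{2i, 2i+1}` selected by the bit `c`. -/
def pairElem {n k : ℕ} (h : 2 * k ≤ n) (i : Fin k) (c : Bool) : Fin n :=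
  ⟨2 * i + c.toNat, by have := i.2; have := c.toNat_lt; omega⟩

theorem pairElem_inj {n k : ℕ} (h : 2 * k ≤ n) {i i' : Fin k} {c c' : Bool} :
    pairElem h i c = pairElem h i' c' ↔ i = i' ∧ c = c' := by
  constructor
  · intro hh
    have hv : 2 * (i : ℕ) + c.toNat = 2 * i' + c'.toNat := congrArg Fin.val hh
    have := c.toNat_lt
    have := c'.toNat_lt
    refine ⟨Fin.ext (by omega), ?_⟩
    cases c <;> cases c' <;> simp_all <;> omega
  · rintro ⟨rfl, rfl⟩
    rfl

theorem ncard_exists_forall_mem_le {m n k M : ℕ} (T : Fin M → Finset (Fin n))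
    (hT : ∀ i, (T i).card ≤ k) :
    Set.ncard {f : Fin m → Fin n | ∃ i, ∀ j, f j ∈ T i} ≤ M * k ^ m := by
  have heq : {f : Fin m → Fin n | ∃ i, ∀ j, f j ∈ T i}
      = ((Finset.univ.biUnion fun i => Fintype.piFinset fun _ : Fin m => T i :
          Finset (Fin m → Fin n)) : Set (Fin m → Fin n)) := by
    ext f
    simp
  rw [heq, Set.ncard_coe_finset]
  refine (Finset.card_biUnion_le_card_mul _ _ (k ^ m) fun i _ => ?_).trans (by simp)
  simpa using Nat.pow_le_pow_left (hT i) m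

/-- There are `M` sets of size at most `n/2` whose `m`-th powers cover at least
`1 - 1/(1 + M/2^m)` of the tuples with coordinates in distinct pairs. -/
theorem exists_sets_covering {m n k : ℕ} (h : 2 * k ≤ n) (M : ℕ) :
    ∃ T : Fin M → Finset (Fin n), (∀ i, (T i).card ≤ k) ∧
      (1 - 1 / (1 + M * (1 / 2 ^ m : ℝ))) * (k.descFactorial m * 2 ^ m)
        ≤ (Set.ncard {f : Fin m → Fin n | ∃ i, ∀ j, f j ∈ T i} : ℝ) := by
  obtain ⟨t, ht⟩ := exists_card_uncovered_le
    (fun (x : (Fin m ↪ Fin k) × (Fin m → Bool)) (s : Fin k → Bool) => ∀ j, s (x.1 j) = x.2 j)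
    (Nat.one_le_two_pow (n := m)) (fun x => by convert card_bool_fun_le_mul_card_restrict_eq x.1 x.2) M
  refine ⟨fun i => Finset.univ.image fun l => pairElem h l (t i l), fun i => ?_, ?_⟩
  · exact Finset.card_image_le.trans (by simp)
  set T : Fin M → Finset (Fin n) := fun i => Finset.univ.image fun l => pairElem h l (t i l)
  set R : (Fin m ↪ Fin k) × (Fin m → Bool) → Prop := fun x => ∀ i, ¬ ∀ j, t i (x.1 j) = x.2 j
  have hcov : (Finset.univ.filter fun x => ¬ R x).card
      ≤ Set.ncard {f : Fin m → Fin n | ∃ i, ∀ j, f j ∈ T i} := by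
    rw [← Set.ncard_coe_finset]
    refine Set.ncard_le_ncard_of_injOn (fun x j => pairElem h (x.1 j) (x.2 j)) ?_ ?_
      (Set.toFinite _)
    · intro x hx
      have hx' : ¬ R x := (Finset.mem_filter.1 hx).2
      obtain ⟨i, hi⟩ := not_forall_not.1 hx'
      refine ⟨i, fun j => Finset.mem_image.2 ⟨x.1 j, Finset.mem_univ _, ?_⟩⟩
      rw [hi]
    · rintro ⟨e, b⟩ _ ⟨e', b'⟩ _ hx
      have hj := fun j => (pairElem_inj h).1 (congrFun hx j)
      exact Prod.ext (DFunLike.ext _ _ fun j => (hj j).1) (funext fun j => (hj j).2)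
  have hsplit := Finset.card_filter_add_card_filter_not R (s := Finset.univ)
  have hX : Fintype.card ((Fin m ↪ Fin k) × (Fin m → Bool)) = k.descFactorial m * 2 ^ m := by
    simp
  rw [Finset.card_univ, hX] at hsplit
  rw [hX] at ht
  push_cast at ht
  have ht' : ((Finset.univ.filter fun x => R x).card : ℝ)
      ≤ (1 - 1 / 2 ^ m) ^ M * (k.descFactorial m * 2 ^ m) := by
    convert ht
  have hcov' : ((Finset.univ.filter fun x => ¬ R x).card : ℝ)
      ≤ Set.ncard {f : Fin m → Fin n | ∃ i, ∀ j, f j ∈ T i} := by exact_mod_cast hcov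
  have hsplit' : ((Finset.univ.filter fun x => R x).card : ℝ)
      + (Finset.univ.filter fun x => ¬ R x).card = k.descFactorial m * 2 ^ m := by
    exact_mod_cast hsplit
  have hpow := one_sub_pow_le_inv_one_add_mul (p := 1 / 2 ^ m) (by positivity)
    (by rw [div_le_one (by positivity)]; exact one_le_pow₀ (by norm_num)) M
  have := mul_le_mul_of_nonneg_right hpow
    (by positivity : (0 : ℝ) ≤ k.descFactorial m * 2 ^ m)
  linarith

theorem two_thirds_mul_pow_le_descFactorial {m n : ℕ} (hm : 1 ≤ m) (hn : 6 * m ^ 2 ≤ n) :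
    2 / 3 * (n : ℝ) ^ m ≤ (n / 2).descFactorial m * 2 ^ m := by
  have hmn : 6 * m ≤ n := by nlinarith
  have hn₀ : (0 : ℝ) < n := by exact_mod_cast (by omega : 0 < n)
  have hn' : 6 * (m : ℝ) ^ 2 ≤ n := by exact_mod_cast hn
  have hmn' : 6 * (m : ℝ) ≤ n := by exact_mod_cast hmn
  have hdesc : (n - 2 * m) ^ m ≤ (n / 2).descFactorial m * 2 ^ m :=
    calc (n - 2 * m) ^ m ≤ ((n / 2 + 1 - m) * 2) ^ m := Nat.pow_le_pow_left (by omega) m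
      _ = (n / 2 + 1 - m) ^ m * 2 ^ m := mul_pow _ _ _
      _ ≤ _ := Nat.mul_le_mul_right _ (Nat.pow_sub_le_descFactorial _ _)
  have hdesc' : ((n : ℝ) - 2 * m) ^ m ≤ (n / 2).descFactorial m * 2 ^ m := by
    have : (((n - 2 * m : ℕ) : ℝ)) ^ m ≤ (n / 2).descFactorial m * 2 ^ m := by
      exact_mod_cast hdesc
    rwa [Nat.cast_sub (by omega), Nat.cast_mul, Nat.cast_ofNat] at this
  refine le_trans ?_ hdesc'
  have hb : 1 + (m : ℝ) * (-(2 * m / n)) ≤ (1 + -(2 * m / n)) ^ m := by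
    refine one_add_mul_le_pow ?_ m
    have : 2 * (m : ℝ) / n ≤ 1 := by
      rw [div_le_one hn₀]
      linarith
    linarith
  have hsmall : 2 * (m : ℝ) ^ 2 / n ≤ 1 / 3 := by
    rw [div_le_iff₀ hn₀]
    linarith
  calc 2 / 3 * (n : ℝ) ^ m ≤ (1 + -(2 * m / n)) ^ m * (n : ℝ) ^ m := by
        gcongr
        refine le_trans ?_ hb
        have : (m : ℝ) * (-(2 * m / n)) = -(2 * (m : ℝ) ^ 2 / n) := by ring
        linarith
    _ = ((n : ℝ) - 2 * m) ^ m := by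
        rw [← mul_pow]
        congr 1
        field_simp
        ring

/-- For every `m ≥ 4` and all sufficiently large `n`, there are
`M = Θ(2^m/m)` subsets `T_1, …, T_M` of `[n]`, each of size at most `n/2`, such that the
union of the `m`-fold powers `T_i^m` occupies a fraction of `[n]^m` between `1/m` and `4/m`. -/
theorem stmt3 (m : ℕ) (hm : 4 ≤ m) :
    ∃ n₀ : ℕ, ∀ n : ℕ, n₀ ≤ n →
      ∃ (M : ℕ) (T : Fin M → Finset (Fin n)),
        ((2 : ℝ) ^ m / m ≤ (M : ℝ)) ∧ ((M : ℝ) ≤ 8 * 2 ^ m / m) ∧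
        (∀ i, 2 * (T i).card ≤ n) ∧
        ((1 / m : ℝ) ≤
          (Set.ncard {f : Fin m → Fin n | ∃ i, ∀ j, f j ∈ T i} : ℝ) / (n : ℝ) ^ m) ∧
        ((Set.ncard {f : Fin m → Fin n | ∃ i, ∀ j, f j ∈ T i} : ℝ) / (n : ℝ) ^ m
          ≤ 4 / m) := by
  have hm₀ : (0 : ℝ) < m := by exact_mod_cast (by omega : 0 < m)
  have hm₄ : (4 : ℝ) ≤ m := by exact_mod_cast hm
  have hpow : (m : ℝ) ≤ 2 ^ m := by exact_mod_cast Nat.lt_two_pow_self.le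
  have hP : (0 : ℝ) < 2 ^ m := by positivity
  refine ⟨6 * m ^ 2, fun n hn => ?_⟩
  have hn₀ : (0 : ℝ) < n := by
    have : 0 < 6 * m ^ 2 := by positivity
    exact_mod_cast (by omega : 0 < n)
  have hnm : (0 : ℝ) < (n : ℝ) ^ m := by positivity
  have hk : 2 * (n / 2) ≤ n := by omega
  set M := 4 * 2 ^ m / m
  have hM_upper : (M : ℝ) * m ≤ 4 * 2 ^ m := by
    exact_mod_cast Nat.div_mul_le_self (4 * 2 ^ m) m
  have hM_lower : 4 * (2 : ℝ) ^ m ≤ M * m + m := by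
    have := Nat.lt_div_mul_add (a := 4 * 2 ^ m) (b := m) (by omega)
    exact_mod_cast this.le
  obtain ⟨T, hTk, hT⟩ := exists_sets_covering (m := m) hk M
  refine ⟨M, T, ?_, ?_, fun i => by have := hTk i; omega, ?_, ?_⟩
  · rw [div_le_iff₀ hm₀]
    linarith
  · rw [le_div_iff₀ hm₀]
    linarith
  · rw [le_div_iff₀ hnm]
    refine le_trans ?_ hT
    have hx_lower : 3 / (m : ℝ) ≤ M * (1 / 2 ^ m) := by
      rw [mul_one_div, div_le_div_iff₀ hm₀ hP]
      linarith
    have hfrac : 3 / 2 * (1 / (m : ℝ)) ≤ 1 - 1 / (1 + M * (1 / 2 ^ m : ℝ)) := by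
      have h₁ : 1 / (1 + M * (1 / 2 ^ m : ℝ)) ≤ 1 / (1 + 3 / m) := by gcongr
      have h₂ : 3 / 2 * (1 / (m : ℝ)) ≤ 1 - 1 / (1 + 3 / m) := by
        have : 1 - 1 / (1 + 3 / (m : ℝ)) = 3 / (m + 3) := by
          field_simp
          ring
        rw [this, mul_one_div, div_le_div_iff₀ hm₀ (by linarith)]
        linarith
      linarith
    have hdesc := two_thirds_mul_pow_le_descFactorial (by omega : 1 ≤ m) hn
    calc 1 / (m : ℝ) * (n : ℝ) ^ m
        = 3 / 2 * (1 / (m : ℝ)) * (2 / 3 * (n : ℝ) ^ m) := by ring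
      _ ≤ _ := mul_le_mul hfrac hdesc (by positivity)
          (le_trans (by positivity) hfrac)
  · have hcard : (Set.ncard {f : Fin m → Fin n | ∃ i, ∀ j, f j ∈ T i} : ℝ)
        ≤ M * ((n / 2 : ℕ) : ℝ) ^ m := by
      exact_mod_cast ncard_exists_forall_mem_le T hTk
    have hhalf : ((n / 2 : ℕ) : ℝ) ^ m ≤ ((n : ℝ) / 2) ^ m := by
      gcongr
      exact Nat.cast_div_le
    rw [div_le_iff₀ hnm]
    calc (Set.ncard {f : Fin m → Fin n | ∃ i, ∀ j, f j ∈ T i} : ℝ)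
        ≤ M * ((n : ℝ) / 2) ^ m := hcard.trans (by gcongr)
      _ = M / 2 ^ m * (n : ℝ) ^ m := by rw [div_pow]; ring
      _ ≤ 4 / m * (n : ℝ) ^ m := by
          gcongr ?_ * _
          rw [div_le_div_iff₀ hP hm₀]
          exact hM_upper
end

section
/- There is a universal constant C > 0 such that: for every integer m ≥ 4 there exists n₀ ≥ m such that for every n ≥ n₀ the following holds. Let X = [n], and let D be the uniform distribution on the examples {(x,1) : x ∈ [n]} ⊆ X × {0,1}. There is a deterministic function A : (X × {0,1})^m → ({0,1}^X) such that, for S ~ D^m, the Shannon entropy H(A(S)) ≤ C (equivalently, the mutual information I(S; A(S)) ≤ C, since A is deterministic), and Pr_{S ~ D^m}[ |êrr(A(S); S) − err(A(S); D)| ≥ 1/2 ] ≥ 1/m. -/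
open scoped Classical

/-- The distribution on `Fin n × Bool` that is uniform on the examples `(x, true)`. -/
noncomputable def unifPos (n : ℕ) : Fin n × Bool → ℝ :=
  fun z => if z.2 then (1 / (n : ℝ)) else 0

/-- The entropy of a subdistribution supported on one point together with `T` is bounded by
the mass of `T` times `K`, plus a constant, as soon as `T` has at most `2 ^ K` elements. -/
theorem ent_le_of_support {α : Type*} [Fintype α] [DecidableEq α]
    (p : α → ℝ) (hp : ∀ a, 0 ≤ p a)
    (c : α) (T : Finset α) (K : ℕ) (hT : T.card ≤ 2 ^ K)
    (hsupp : ∀ a, a ≠ c → a ∉ T → p a = 0) :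
    ent p ≤ K * ∑ a ∈ Finset.univ.erase c, p a + 4 := by
  have hlog : (1 : ℝ) / 2 ≤ Real.log 2 := by linarith [Real.log_two_gt_d9]
  have key : ∀ x : ℝ, 0 ≤ x → ∀ k : ℕ,
      -(x * Real.logb 2 x) ≤ k * x + 2 * (1 / 2 : ℝ) ^ k := by
    intro x hx k
    rcases hx.eq_or_lt with rfl | hx
    · simp
    have h1 := Real.log_le_sub_one_of_pos (x := (1 / 2 : ℝ) ^ k / x) (by positivity)
    rw [Real.log_div (by positivity) hx.ne', Real.log_pow, one_div, Real.log_inv] at h1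
    have h2 : x * (k * -Real.log 2 - Real.log x) ≤ (1 / 2 : ℝ) ^ k := by
      have := mul_le_mul_of_nonneg_left h1 hx.le
      rw [mul_sub x (_ / x), mul_div_cancel₀ _ hx.ne'] at this
      norm_num at this ⊢
      linarith
    have h3 : -(x * Real.logb 2 x) = (-(x * Real.log x)) / Real.log 2 := by
      rw [Real.logb]; ring
    rw [h3, div_le_iff₀ (by linarith)]
    have h4 : (0 : ℝ) < (1 / 2 : ℝ) ^ k := by positivity
    nlinarith
  have hc : -(p c * Real.logb 2 (p c)) ≤ 2 := by
    simpa using key (p c) (hp c) 0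
  have hrest : ∑ a ∈ Finset.univ.erase c, -(p a * Real.logb 2 (p a)) ≤
      ∑ a ∈ Finset.univ.erase c, (K * p a + if a ∈ T then 2 * (1 / 2 : ℝ) ^ K else 0) := by
    refine Finset.sum_le_sum fun a ha => ?_
    by_cases haT : a ∈ T
    · simpa [haT] using key (p a) (hp a) K
    · simp [haT, hsupp a (Finset.ne_of_mem_erase ha) haT]
  have hcount : ∑ a ∈ Finset.univ.erase c, (if a ∈ T then 2 * (1 / 2 : ℝ) ^ K else 0) ≤ 2 := by
    calc _ ≤ ∑ a, (if a ∈ T then 2 * (1 / 2 : ℝ) ^ K else 0) :=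
          Finset.sum_le_sum_of_subset_of_nonneg (Finset.subset_univ _)
            fun a _ _ => by split_ifs <;> positivity
      _ = T.card * (2 * (1 / 2 : ℝ) ^ K) := by simp
      _ ≤ 2 ^ K * (2 * (1 / 2 : ℝ) ^ K) := by
          gcongr
          exact_mod_cast hT
      _ = 2 := by rw [mul_left_comm, ← mul_pow]; norm_num
  rw [ent, ← Finset.sum_neg_distrib, ← Finset.add_sum_erase _ _ (Finset.mem_univ c)]
  rw [Finset.sum_add_distrib, ← Finset.mul_sum] at hrest
  linarith

/-- The expectation under a product distribution of a function of one coordinate. -/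
theorem sum_mul_prod_eq_marginal {ι Z : Type*} [Fintype ι] [DecidableEq ι] [Fintype Z]
    (u : Z → ℝ) (hu : ∑ z, u z = 1) (i₀ : ι) (g : Z → ℝ) :
    ∑ s : ι → Z, g (s i₀) * ∏ i, u (s i) = ∑ z, g z * u z := by
  have h := Fintype.prod_sum (fun (i : ι) (z : Z) => (if i = i₀ then g z else 1) * u z)
  have hr : ∀ s : ι → Z, ∏ i, ((if i = i₀ then g (s i) else 1) * u (s i)) =
      g (s i₀) * ∏ i, u (s i) := fun s => by
    rw [Finset.prod_mul_distrib]; simp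
  simp_rw [hr] at h
  rw [← h, Finset.prod_eq_single i₀]
  · simp
  · intro i _ hi
    simp [hi, hu]
  · simp

theorem unifPos_nonneg (n : ℕ) (z : Fin n × Bool) : 0 ≤ unifPos n z := by
  unfold unifPos; split_ifs <;> positivity

theorem sum_mul_unifPos (n : ℕ) (g : Fin n × Bool → ℝ) :
    ∑ z, g z * unifPos n z = (∑ x, g (x, true)) / n := by
  rw [Fintype.sum_prod_type, Finset.sum_div]
  simp [unifPos, div_eq_mul_inv]

theorem sum_unifPos {n : ℕ} (hn : 0 < n) : ∑ z, unifPos n z = 1 := by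
  have hn' : (n : ℝ) ≠ 0 := by positivity
  simpa [hn'] using sum_mul_unifPos n (fun _ => 1)

theorem card_filter_mod_eq_le (n d r : ℕ) :
    (Finset.univ.filter fun x : Fin n => x.val % d = r).card ≤ n / d + 1 := by
  calc _ ≤ (Finset.range (n / d + 1)).card := by
        refine Finset.card_le_card_of_injOn (fun x => x.val / d) ?_ ?_
        · intro x _
          simpa [Nat.lt_succ_iff] using Nat.div_le_div_right (c := d) x.isLt.le
        · intro x hx y hy hxy
          simp only [Finset.coe_filter, Finset.mem_univ, true_and, Set.mem_ofPred_eq] at hx hy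
          apply Fin.ext
          rw [← Nat.div_add_mod x.val d, ← Nat.div_add_mod y.val d, hx, hy]
          simp only at hxy
          rw [hxy]
    _ = _ := by simp

/-- The indicator of the union of the residue classes modulo `4 * m` hit by the sample. -/
def hitClasses {m n : ℕ} (s : Fin m → Fin n × Bool) (x : Fin n) : Bool :=
  decide (∃ i, x.val % (4 * m) = (s i).1.val % (4 * m))

theorem card_hitClasses_le {m n : ℕ} (hn : 4 * m ≤ n)
    (s : Fin m → Fin n × Bool) :
    2 * (Finset.univ.filter fun x => hitClasses s x = true).card ≤ n := by
  have hsub : (Finset.univ.filter fun x => hitClasses s x = true) ⊆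
      Finset.univ.biUnion fun i : Fin m =>
        Finset.univ.filter fun x : Fin n => x.val % (4 * m) = (s i).1.val % (4 * m) := by
    intro x
    simp [hitClasses]
  have hcard := (Finset.card_le_card hsub).trans
    (Finset.card_biUnion_le_card_mul _ _ (n / (4 * m) + 1)
      fun i _ => card_filter_mod_eq_le n (4 * m) _)
  have hdiv := Nat.div_mul_le_self n (4 * m)
  simp only [Finset.card_univ, Fintype.card_fin] at hcard
  nlinarith

theorem trueErr_unifPos {n : ℕ} (hn : 0 < n) (h : Fin n → Bool) :
    trueErr (unifPos n) h = 1 - (Finset.univ.filter fun x => h x = true).card / (n : ℝ) := by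
  have hn' : (n : ℝ) ≠ 0 := by positivity
  simp_rw [trueErr, mul_comm (unifPos n _)]
  rw [sum_mul_unifPos, eq_sub_iff_add_eq, ← add_div, div_eq_one_iff_eq hn']
  have := Finset.card_filter_add_card_filter_not (s := (Finset.univ : Finset (Fin n)))
    (fun x => h x = true)
  simp only [Finset.card_univ, Fintype.card_fin] at this
  rw [Finset.sum_boole, add_comm]
  exact_mod_cast this

theorem half_le_gap_hitClasses {m n : ℕ} (hm : 0 < m) (hn : 4 * m ≤ n)
    (s : Fin m → Fin n × Bool) (hs : ∀ i, (s i).2 = true) :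
    (1 : ℝ) / 2 ≤ |empErr s (hitClasses s) - trueErr (unifPos n) (hitClasses s)| := by
  have hemp : empErr s (hitClasses s) = 0 := by
    have : ∀ i, hitClasses s (s i).1 = true := fun i => by
      simpa [hitClasses] using ⟨i, rfl⟩
    simp [empErr, hs, this]
  have hn' : (0 : ℝ) < n := by exact_mod_cast (by omega : 0 < n)
  have hcard : (2 : ℝ) * (Finset.univ.filter fun x => hitClasses s x = true).card ≤ n := by
    exact_mod_cast card_hitClasses_le hn s
  rw [hemp, trueErr_unifPos (by omega), zero_sub, abs_neg]
  refine le_trans ?_ (le_abs_self _)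
  rw [le_sub_comm, div_le_iff₀ hn']
  linarith

theorem card_range_hitClasses_le {m n : ℕ} (hm : 0 < m) :
    (Finset.univ.image (hitClasses : (Fin m → Fin n × Bool) → Fin n → Bool)).card
      ≤ 2 ^ (4 * m) := by
  have hsub : Finset.univ.image (hitClasses : (Fin m → Fin n × Bool) → Fin n → Bool) ⊆
      (Finset.range (4 * m)).powerset.image
        fun W (x : Fin n) => decide (x.val % (4 * m) ∈ W) := by
    intro h hh
    obtain ⟨s, -, rfl⟩ := Finset.mem_image.1 hh
    refine Finset.mem_image.2
      ⟨Finset.univ.image fun i => (s i).1.val % (4 * m), ?_, ?_⟩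
    · rw [Finset.mem_powerset]
      intro r hr
      obtain ⟨i, -, rfl⟩ := Finset.mem_image.1 hr
      exact Finset.mem_range.2 (Nat.mod_lt _ (by positivity))
    · funext x
      simp [hitClasses, eq_comm]
  refine (Finset.card_le_card hsub).trans (Finset.card_image_le.trans ?_)
  simp

/-- There is a universal constant `C > 0` such that for every `m ≥ 4` and
all sufficiently large `n ≥ m`: with `D` uniform on `{(x, 1) : x ∈ [n]}`, there is a
deterministic algorithm `A` whose output entropy is at most `C` bits (equivalently
`I(S; A(S)) ≤ C`, since `A` is deterministic), yet with probability at least `1/m` over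
`S ~ D^m` the empirical and true errors of `A(S)` differ by at least `1/2`. -/
theorem stmt4 :
    ∃ C : ℝ, 0 < C ∧ ∀ m : ℕ, 4 ≤ m → ∃ n₀ : ℕ, m ≤ n₀ ∧ ∀ n : ℕ, n₀ ≤ n →
      ∃ A : (Fin m → Fin n × Bool) → (Fin n → Bool),
        (ent (fun h : Fin n → Bool =>
            ∑ s ∈ Finset.univ.filter (fun s : Fin m → Fin n × Bool => A s = h),
              ∏ i, unifPos n (s i)) ≤ C) ∧
        ((1 / m : ℝ) ≤ ∑ s ∈ Finset.univ.filter
            (fun s : Fin m → Fin n × Bool =>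
              (1 : ℝ) / 2 ≤ |empErr s (A s) - trueErr (unifPos n) (A s)|),
            ∏ i, unifPos n (s i)) := by
  refine ⟨12, by norm_num, fun m hm => ⟨4 * m, by omega, fun n hn => ?_⟩⟩
  have hm0 : (0 : ℝ) < m := by exact_mod_cast (by omega : 0 < m)
  have hn0 : (0 : ℝ) < n := by exact_mod_cast (by omega : 0 < n)
  let i₀ : Fin m := ⟨0, by omega⟩
  let k : ℕ := n / m + 1
  have hkn : k ≤ n := by
    have : n / m ≤ n / 4 := Nat.div_le_div_left hm (by norm_num)
    omega
  have hk_lower : (n : ℝ) ≤ m * k := by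
    exact_mod_cast (Nat.lt_mul_div_succ n (by omega : 0 < m)).le
  have hk_upper : (m : ℝ) * k ≤ 2 * n := by
    have : m * k ≤ 2 * n := by
      have := Nat.mul_div_le n m
      simp only [k, mul_add]
      omega
    exact_mod_cast this
  let w : (Fin m → Fin n × Bool) → ℝ := fun s => ∏ i, unifPos n (s i)
  have hw : ∀ s, 0 ≤ w s := fun s => Finset.prod_nonneg fun i _ => unifPos_nonneg n (s i)
  let c : Fin n → Bool := fun _ => true
  let A : (Fin m → Fin n × Bool) → (Fin n → Bool) :=
    fun s => if (s i₀).1.val < k then hitClasses s else c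
  have hevent : ∑ s, (if (s i₀).1.val < k then 1 else 0) * w s = (k : ℝ) / n := by
    refine (sum_mul_prod_eq_marginal (unifPos n) (sum_unifPos (by omega)) i₀
      (fun z => if z.1.val < k then 1 else 0)).trans ?_
    rw [sum_mul_unifPos]
    simp [Fin.card_filter_val_lt, hkn]
  refine ⟨A, ?_, ?_⟩
  · refine (ent_le_of_support _ (fun h => Finset.sum_nonneg fun s _ => hw s) c
      (Finset.univ.image hitClasses) (4 * m)
      (card_range_hitClasses_le (by omega)) ?_).trans ?_
    · intro h hc hT
      refine Finset.sum_eq_zero fun s hs => ?_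
      have hs' : A s = h := (Finset.mem_filter.1 hs).2
      by_cases hlt : (s i₀).1.val < k
      · exact absurd (Finset.mem_image.2 ⟨s, Finset.mem_univ s, by simpa [A, hlt] using hs'⟩) hT
      · exact absurd (by simpa [A, hlt] using hs'.symm) hc
    · have hmass : ∑ h ∈ Finset.univ.erase c,
          ∑ s ∈ Finset.univ.filter (fun s => A s = h), w s ≤ (k : ℝ) / n := by
        rw [← hevent]
        simp_rw [Finset.sum_filter]
        rw [Finset.sum_comm]
        refine Finset.sum_le_sum fun s _ => ?_
        rw [Finset.sum_ite_eq]
        by_cases hlt : (s i₀).1.val < k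
        · simp only [hlt, if_true, one_mul]
          split_ifs
          exacts [le_rfl, hw s]
        · simp [A, hlt]
      have hkn' : (m : ℝ) * (k / n) ≤ 2 := by
        rw [← mul_div_assoc, div_le_iff₀ hn0]
        exact hk_upper
      have := mul_le_mul_of_nonneg_left hmass hm0.le
      push_cast
      linarith
  · calc (1 / m : ℝ) ≤ k / n := by
          rw [div_le_div_iff₀ hm0 hn0]
          linarith
      _ = ∑ s, (if (s i₀).1.val < k then 1 else 0) * w s := hevent.symm
      _ ≤ _ := by
          rw [Finset.sum_filter]
          refine Finset.sum_le_sum fun s _ => ?_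
          by_cases hlt : (s i₀).1.val < k
          · by_cases hs : ∀ i, (s i).2 = true
            · have := half_le_gap_hitClasses (by omega) hn s hs
              simp only [A, hlt, if_true, one_mul, if_pos this, w, le_refl]
            · obtain ⟨i, hi⟩ := not_forall.1 hs
              have hws : ∏ i, unifPos n (s i) = 0 :=
                Finset.prod_eq_zero (Finset.mem_univ i) (by simp [unifPos, hi])
              simp [w, hws]
          · simp only [hlt, if_false, zero_mul]
            split_ifs
            exacts [hw s, le_rfl]
end

section
/- Let n ≥ 1 and let Q be a symmetric 2^n × 2^n matrix with natural-number entries (indexed by [2^n] × [2^n]) such that for all i, j: min{i,j} ≤ Q_{ij} ≤ max{i,j}. Then Q contains a row with at least n + 1 distinct values, i.e., there exists an index r such that |{Q_{rj} : j ∈ [2^n]}| ≥ n + 1. -/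
open Finset in
/-- A symmetric matrix on a block of `2 ^ n` consecutive indices whose entries lie between their
two indices has a row with at least `n + 1` distinct values. -/
theorem exists_row_card_image_of_between (Q : ℕ → ℕ → ℕ) (n a : ℕ)
    (hsym : ∀ i ∈ Ioc a (a + 2 ^ n), ∀ j ∈ Ioc a (a + 2 ^ n), Q i j = Q j i)
    (hQ : ∀ i ∈ Ioc a (a + 2 ^ n), ∀ j ∈ Ioc a (a + 2 ^ n),
      min i j ≤ Q i j ∧ Q i j ≤ max i j) :
    ∃ r ∈ Ioc a (a + 2 ^ n), n + 1 ≤ ((Ioc a (a + 2 ^ n)).image (Q r)).card := by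
  induction n generalizing a with
  | zero =>
    have h : a + 1 ∈ Ioc a (a + 2 ^ 0) := by simp
    exact ⟨a + 1, h, Finset.card_pos.2 ⟨_, mem_image_of_mem _ h⟩⟩
  | succ n ih =>
    have hpow : a + 2 ^ (n + 1) = a + 2 ^ n + 2 ^ n := by ring
    rw [hpow] at hsym hQ ⊢
    have hlow : Ioc a (a + 2 ^ n) ⊆ Ioc a (a + 2 ^ n + 2 ^ n) :=
      Ioc_subset_Ioc_right (Nat.le_add_right _ _)
    have hhigh : Ioc (a + 2 ^ n) (a + 2 ^ n + 2 ^ n) ⊆ Ioc a (a + 2 ^ n + 2 ^ n) :=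
      Ioc_subset_Ioc_left (Nat.le_add_right _ _)
    obtain ⟨r, hr, hrc⟩ := ih a (fun i hi j hj => hsym i (hlow hi) j (hlow hj))
      (fun i hi j hj => hQ i (hlow hi) j (hlow hj))
    obtain ⟨s, hs, hsc⟩ := ih (a + 2 ^ n) (fun i hi j hj => hsym i (hhigh hi) j (hhigh hj))
      (fun i hi j hj => hQ i (hhigh hi) j (hhigh hj))
    have card_succ_le : ∀ (S T : Finset ℕ) (f : ℕ → ℕ), S ⊆ T → n + 1 ≤ (S.image f).card →
        ∀ x ∈ T, f x ∉ S.image f → n + 1 + 1 ≤ (T.image f).card := by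
      intro S T f hST hS x hx hxS
      have hlt := card_lt_card ((ssubset_iff_of_subset (image_subset_image hST)).2
        ⟨f x, mem_image_of_mem f hx, hxS⟩)
      omega
    rcases le_or_gt (Q r s) (a + 2 ^ n) with h | h
    · refine ⟨s, hhigh hs, card_succ_le _ _ _ hhigh hsc r (hlow hr) fun hmem => ?_⟩
      obtain ⟨j, hj, hj'⟩ := mem_image.1 hmem
      have hmin := (hQ s (hhigh hs) j (hhigh hj)).1
      have hrs := hsym r (hlow hr) s (hhigh hs)
      rw [mem_Ioc] at hs hj
      omega
    · refine ⟨r, hlow hr, card_succ_le _ _ _ hlow hrc s (hhigh hs) fun hmem => ?_⟩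
      obtain ⟨j, hj, hj'⟩ := mem_image.1 hmem
      have hmax := (hQ r (hlow hr) j (hlow hj)).2
      rw [mem_Ioc] at hr hj
      omega

/-- If `Q` is a symmetric `2^n × 2^n` matrix with natural-number entries
(indexed by `[2^n] = {1, …, 2^n}`) satisfying `min{i,j} ≤ Q_{ij} ≤ max{i,j}`, then some
row of `Q` contains at least `n + 1` distinct values. -/
theorem stmt6 (n : ℕ) (hn : 1 ≤ n) (Q : ℕ → ℕ → ℕ)
    (hsym : ∀ i ∈ Finset.Icc 1 (2 ^ n), ∀ j ∈ Finset.Icc 1 (2 ^ n), Q i j = Q j i)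
    (hQ : ∀ i ∈ Finset.Icc 1 (2 ^ n), ∀ j ∈ Finset.Icc 1 (2 ^ n),
      min i j ≤ Q i j ∧ Q i j ≤ max i j) :
    ∃ r ∈ Finset.Icc 1 (2 ^ n),
      n + 1 ≤ ((Finset.Icc 1 (2 ^ n)).image (fun j => Q r j)).card := by
  have hIoc : Finset.Icc 1 (2 ^ n) = Finset.Ioc 0 (0 + 2 ^ n) := by
    ext x
    simp [Nat.one_le_iff_ne_zero, Nat.pos_iff_ne_zero]
  rw [hIoc] at hsym hQ ⊢
  exact exists_row_card_image_of_between Q n 0 hsym hQ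
end

section
/- Let p and q be probability distributions on a finite set X. Then the contribution of the terms with p(x) < q(x) to the KL-divergence is strictly greater than −1: Σ_{x : p(x) < q(x)} p(x)·log₂(p(x)/q(x)) > −1 (with the convention that terms with p(x) = 0 are 0). -/
open scoped Classical

theorem neg_half_le_mul_log_div {a b : ℝ} (ha : 0 ≤ a) (hb : 0 < b) :
    -(b / 2) ≤ a * Real.log (a / b) := by
  rcases ha.eq_or_lt with rfl | ha
  · simpa using (half_pos hb).le
  · have h := Real.log_le_sub_one_of_pos (show 0 < b / (2 * a) by positivity)
    rw [Real.log_div hb.ne' (by positivity), Real.log_mul two_ne_zero ha.ne'] at h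
    have h2 := mul_le_mul_of_nonneg_left h ha.le
    have h3 : a * (b / (2 * a) - 1) = b / 2 - a := by field_simp
    rw [Real.log_div ha.ne' hb.ne']
    nlinarith [Real.log_two_lt_d9]

/-- For probability distributions `p, q` on a finite set, the contribution
to the KL-divergence (in bits) of the terms with `p(x) < q(x)` is strictly greater
than `−1`. (Terms with `p x = 0` vanish automatically since `0 · log₂(0/q(x)) = 0`.) -/
theorem stmt7 {X : Type*} [Fintype X] (p q : X → ℝ)
    (hp0 : ∀ x, 0 ≤ p x) (hp1 : ∑ x, p x = 1)
    (hq0 : ∀ x, 0 ≤ q x) (hq1 : ∑ x, q x = 1) :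
    -1 < ∑ x ∈ Finset.univ.filter (fun x => p x < q x),
        p x * Real.logb 2 (p x / q x) := by
  have hlog : 1 / 2 < Real.log 2 := by linarith [Real.log_two_gt_d9]
  have hterm : ∀ x ∈ Finset.univ.filter (fun x => p x < q x),
      -(q x / 2) / Real.log 2 ≤ p x * Real.logb 2 (p x / q x) := by
    intro x hx
    have hx := (Finset.mem_filter.mp hx).2
    rw [Real.logb, ← mul_div_assoc]
    exact div_le_div_of_nonneg_right
      (neg_half_le_mul_log_div (hp0 x) ((hp0 x).trans_lt hx)) (by linarith)
  have hmass : ∑ x ∈ Finset.univ.filter (fun x => p x < q x), q x ≤ 1 :=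
    hq1 ▸ Finset.sum_le_sum_of_subset_of_nonneg (Finset.filter_subset _ _) fun x _ _ => hq0 x
  refine lt_of_lt_of_le ?_ (Finset.sum_le_sum hterm)
  rw [← Finset.sum_div, Finset.sum_neg_distrib, ← Finset.sum_div, lt_div_iff₀ (by linarith)]
  linarith
end

section
/- Let n ≥ 2 and let p_1, …, p_n be probability distributions on [n] such that p_i(i) ≥ 1/2 for every i ∈ [n]. Let U be a random variable uniformly distributed on [n], and let T be a random variable on [n] obtained by sampling i according to U and then sampling T according to p_i. Then I(U; T) ≥ (1/2)·log₂(n/2) − 1. -/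
open scoped Classical

/-- Pointwise Gibbs inequality for a weight `m` against the product weight `q * r`. -/
lemma gibbs_pointwise {m q r : ℝ} (hm : 0 ≤ m) (hmq : m ≤ q) (hr : 0 < r) :
    (m - q * r) / Real.log 2 ≤ m * Real.logb 2 m - m * Real.logb 2 q - m * Real.logb 2 r := by
  have h2 : 0 < Real.log 2 := Real.log_pos one_lt_two
  simp only [Real.logb]
  rw [div_le_iff₀ h2]
  have key : m - q * r ≤ m * Real.log m - m * Real.log q - m * Real.log r := by
    rcases hm.eq_or_lt with rfl | hm
    · simpa using mul_nonneg hmq hr.le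
    · have hq : 0 < q := hm.trans_le hmq
      have h := Real.log_le_sub_one_of_pos (div_pos (mul_pos hq hr) hm)
      rw [Real.log_div (mul_pos hq hr).ne' hm.ne', Real.log_mul hq.ne' hr.ne'] at h
      have h' := mul_le_mul_of_nonneg_left h hm.le
      have e : m * (q * r / m - 1) = q * r - m := by field_simp
      linarith
  refine key.trans_eq ?_
  field_simp

/-- Bounding the mutual information from below by means of a (sub-normalised) reverse channel
`r`, which guesses the first coordinate from the second. -/
lemma le_mutInfo_of_reverse_channel {α β : Type*} [Fintype α] [Fintype β] {μ : α × β → ℝ}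
    (hμ : ∀ x, 0 ≤ μ x) {r : α → β → ℝ} (hr : ∀ a b, 0 < r a b) (hr1 : ∀ b, ∑ a, r a b ≤ 1) :
    ent (fun a => ∑ b, μ (a, b)) + ∑ a, ∑ b, μ (a, b) * Real.logb 2 (r a b) ≤ mutInfo μ := by
  set q : β → ℝ := fun b => ∑ a, μ (a, b) with hq
  have hq0 : ∀ b, 0 ≤ q b := fun b => Finset.sum_nonneg fun a _ => hμ _
  have hle : ∀ a b, μ (a, b) ≤ q b := fun a b =>
    Finset.single_le_sum (f := fun a => μ (a, b)) (fun a _ => hμ _) (Finset.mem_univ a)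
  have hsum : ∑ a, ∑ b, (μ (a, b) - q b * r a b) / Real.log 2 ≤
      ∑ a, ∑ b, (μ (a, b) * Real.logb 2 (μ (a, b)) - μ (a, b) * Real.logb 2 (q b)
        - μ (a, b) * Real.logb 2 (r a b)) :=
    Finset.sum_le_sum fun a _ => Finset.sum_le_sum fun b _ =>
      gibbs_pointwise (hμ _) (hle a b) (hr a b)
  have hnonneg : 0 ≤ ∑ a, ∑ b, (μ (a, b) - q b * r a b) / Real.log 2 := by
    rw [Finset.sum_comm]
    refine Finset.sum_nonneg fun b _ => ?_
    rw [← Finset.sum_div, Finset.sum_sub_distrib, ← Finset.mul_sum]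
    refine div_nonneg ?_ (Real.log_pos one_lt_two).le
    have := mul_le_mul_of_nonneg_left (hr1 b) (hq0 b)
    change 0 ≤ q b - _
    linarith
  have hqsum : ∑ a, ∑ b, μ (a, b) * Real.logb 2 (q b) = ∑ b, q b * Real.logb 2 (q b) := by
    rw [Finset.sum_comm]
    exact Finset.sum_congr rfl fun b _ => (Finset.sum_mul _ _ _).symm
  simp only [Finset.sum_sub_distrib] at hsum
  rw [hqsum] at hsum
  have hμent : ent μ = -∑ a, ∑ b, μ (a, b) * Real.logb 2 (μ (a, b)) := by
    rw [ent, Fintype.sum_prod_type]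
  have hqent : ent q = -∑ b, q b * Real.logb 2 (q b) := rfl
  rw [mutInfo, hμent, ← hq, hqent]
  linarith

/-- Let `p_1, …, p_n` be distributions on `[n]` with `p_i(i) ≥ 1/2` for
all `i`. If `U` is uniform on `[n]` and `T` is sampled from `p_U`, then
`I(U; T) ≥ (1/2)·log₂(n/2) − 1`. -/
theorem stmt8 (n : ℕ) (hn : 2 ≤ n) (p : Fin n → Fin n → ℝ)
    (hp0 : ∀ i j, 0 ≤ p i j) (hp1 : ∀ i, ∑ j, p i j = 1)
    (hdiag : ∀ i, (1 : ℝ) / 2 ≤ p i i) :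
    (1 / 2 : ℝ) * Real.logb 2 ((n : ℝ) / 2) - 1 ≤
      mutInfo (fun x : Fin n × Fin n => (1 / (n : ℝ)) * p x.1 x.2) := by
  have hn0 : (0 : ℝ) < n := by exact_mod_cast (by omega : 0 < n)
  have hn2 : (2 : ℝ) ≤ n := by exact_mod_cast hn
  have hlog : 0 ≤ Real.logb 2 (n : ℝ) := Real.logb_nonneg one_lt_two (by linarith)
  let r : Fin n → Fin n → ℝ := fun i j => if i = j then 1 / 2 else 1 / (2 * n)
  have hr : ∀ i j, 0 < r i j := fun i j => by
    dsimp only [r]; split_ifs <;> positivity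
  have hr1 : ∀ j, ∑ i, r i j ≤ 1 := fun j => by
    calc ∑ i, r i j ≤ ∑ i : Fin n, ((if i = j then (1 / 2 : ℝ) else 0) + 1 / (2 * n)) :=
          Finset.sum_le_sum fun i _ => by
            dsimp only [r]
            split_ifs
            · exact le_add_of_nonneg_right (by positivity)
            · simp
      _ = 1 := by
          rw [Finset.sum_add_distrib, Finset.sum_ite_eq' Finset.univ j]
          simp
          field_simp
          norm_num
  have hlogr : ∀ i j, Real.logb 2 (r i j) =
      (if i = j then Real.logb 2 (n : ℝ) else 0) - (1 + Real.logb 2 (n : ℝ)) := fun i j => by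
    have h2 : Real.logb 2 (2 : ℝ) = 1 := Real.logb_self_eq_one one_lt_two
    dsimp only [r]
    split_ifs
    · rw [one_div, Real.logb_inv, h2]; ring
    · rw [one_div, Real.logb_inv, Real.logb_mul two_ne_zero hn0.ne', h2]; ring
  have h := le_mutInfo_of_reverse_channel
    (μ := fun x : Fin n × Fin n => (1 / (n : ℝ)) * p x.1 x.2)
    (fun x => mul_nonneg (by positivity) (hp0 _ _)) hr hr1
  have hent : ent (fun i : Fin n => ∑ j, 1 / (n : ℝ) * p i j) = Real.logb 2 (n : ℝ) := by
    simp only [← Finset.mul_sum, hp1, ent]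
    simp [hn0.ne']
  have hdiagsum : (n : ℝ) * (1 / 2) ≤ ∑ i, p i i := by
    simpa using Finset.sum_le_sum fun i (_ : i ∈ Finset.univ) => hdiag i
  have hcross : ∑ i, ∑ j, 1 / (n : ℝ) * p i j * Real.logb 2 (r i j) =
      1 / n * (∑ i, p i i) * Real.logb 2 (n : ℝ) - (1 + Real.logb 2 (n : ℝ)) := by
    simp only [hlogr, mul_sub, Finset.sum_sub_distrib, mul_ite, mul_zero, Finset.sum_ite_eq,
      Finset.mem_univ, if_true, ← Finset.sum_mul, ← Finset.mul_sum, hp1]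
    simp [hn0.ne']
  have hP : 1 / 2 ≤ 1 / (n : ℝ) * ∑ i, p i i := by
    rw [one_div_mul_eq_div, le_div_iff₀ hn0]
    linarith
  have hPlog := mul_le_mul_of_nonneg_right hP hlog
  dsimp only at h
  rw [hent, hcross] at h
  rw [Real.logb_div hn0.ne' two_ne_zero, Real.logb_self_eq_one one_lt_two]
  linarith
end

section
/- Let n ≥ 2, let 𝒳 be a finite set, let p_1, …, p_n be probability distributions on 𝒳, and let S_1, …, S_n ⊆ 𝒳 be pairwise disjoint sets such that p_i(S_i) ≥ 1/2 for every i ∈ [n]. Let U be a random variable uniformly distributed on [n], and let W be a random variable on 𝒳 obtained by sampling i according to U and then sampling W according to p_i. Then I(U; W) ≥ (1/2)·log₂(n/2) − 1. -/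
open scoped Classical

/-- Gibbs' inequality for conditional distributions: for a joint weight function `μ` and a
sub-stochastic positive kernel `r`, the conditional entropy of the first coordinate given the
second is at most the cross entropy relative to `r`. -/
theorem sum_mul_logb_le_ent_sub_ent {α β : Type*} [Fintype α] [Fintype β] (μ : α × β → ℝ)
    (hμ : ∀ q, 0 ≤ μ q) (r : α → β → ℝ) (hr : ∀ a b, 0 < r a b) (hr1 : ∀ b, ∑ a, r a b ≤ 1) :
    ∑ a, ∑ b, μ (a, b) * Real.logb 2 (r a b) ≤ ent (fun b => ∑ a, μ (a, b)) - ent μ := by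
  set m : β → ℝ := fun b => ∑ a, μ (a, b) with hm
  have hm0 : ∀ b, 0 ≤ m b := fun b => Finset.sum_nonneg fun a _ => hμ _
  have hlog2 : 0 < Real.log 2 := Real.log_pos one_lt_two
  have hpoint : ∀ a b, (μ (a, b) - m b * r a b) / Real.log 2 ≤
      μ (a, b) * Real.logb 2 (μ (a, b)) - μ (a, b) * Real.logb 2 (m b)
        - μ (a, b) * Real.logb 2 (r a b) := by
    intro a b
    have hle : μ (a, b) ≤ m b :=
      Finset.single_le_sum (f := fun a => μ (a, b)) (fun a _ => hμ _) (Finset.mem_univ a)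
    rcases (hμ (a, b)).eq_or_lt with h0 | hpos
    · rw [← h0]
      have := mul_nonneg (hm0 b) (hr a b).le
      simp only [zero_mul, sub_zero, zero_sub]
      exact div_nonpos_of_nonpos_of_nonneg (by linarith) hlog2.le
    · have hmpos : 0 < m b := hpos.trans_le hle
      have hmr : 0 < m b * r a b := mul_pos hmpos (hr a b)
      have key := Real.log_le_sub_one_of_pos (div_pos hmr hpos)
      rw [Real.log_div hmr.ne' hpos.ne', Real.log_mul hmpos.ne' (hr a b).ne'] at key
      have key' := mul_le_mul_of_nonneg_left key hpos.le
      have hcancel : μ (a, b) * (m b * r a b / μ (a, b) - 1) = m b * r a b - μ (a, b) := by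
        field_simp
      rw [hcancel] at key'
      have hrhs : μ (a, b) * Real.logb 2 (μ (a, b)) - μ (a, b) * Real.logb 2 (m b)
          - μ (a, b) * Real.logb 2 (r a b) = (μ (a, b) * Real.log (μ (a, b))
            - μ (a, b) * Real.log (m b) - μ (a, b) * Real.log (r a b)) / Real.log 2 := by
        simp only [Real.logb]
        ring
      rw [hrhs]
      exact div_le_div_of_nonneg_right (by linarith) hlog2.le
  have hsum := Finset.sum_le_sum fun a (_ : a ∈ Finset.univ) =>
    Finset.sum_le_sum fun b (_ : b ∈ Finset.univ) => hpoint a b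
  have hnonneg : 0 ≤ ∑ a, ∑ b, (μ (a, b) - m b * r a b) / Real.log 2 := by
    rw [Finset.sum_comm]
    refine Finset.sum_nonneg fun b _ => ?_
    rw [← Finset.sum_div, Finset.sum_sub_distrib, ← Finset.mul_sum]
    refine div_nonneg ?_ hlog2.le
    have := mul_le_mul_of_nonneg_left (hr1 b) (hm0 b)
    change 0 ≤ m b - _
    linarith
  have hcomm : ∑ a, ∑ b, μ (a, b) * Real.logb 2 (m b) = ∑ b, m b * Real.logb 2 (m b) := by
    rw [Finset.sum_comm]
    simp only [hm, Finset.sum_mul]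
  simp only [Finset.sum_sub_distrib] at hsum
  rw [hcomm] at hsum
  simp only [ent, Fintype.sum_prod_type]
  linarith

/-- Let `p_1, …, p_n` be distributions on a finite set `𝒳` and
`S_1, …, S_n ⊆ 𝒳` pairwise disjoint with `p_i(S_i) ≥ 1/2` for all `i`. If `U` is uniform
on `[n]` and `W` is sampled from `p_U`, then `I(U; W) ≥ (1/2)·log₂(n/2) − 1`. -/
theorem stmt9 {𝒳 : Type*} [Fintype 𝒳] (n : ℕ) (hn : 2 ≤ n)
    (p : Fin n → 𝒳 → ℝ) (hp0 : ∀ i x, 0 ≤ p i x) (hp1 : ∀ i, ∑ x, p i x = 1)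
    (S : Fin n → Finset 𝒳) (hdisj : ∀ i j, i ≠ j → Disjoint (S i) (S j))
    (hS : ∀ i, (1 : ℝ) / 2 ≤ ∑ x ∈ S i, p i x) :
    (1 / 2 : ℝ) * Real.logb 2 ((n : ℝ) / 2) - 1 ≤
      mutInfo (fun q : Fin n × 𝒳 => (1 / (n : ℝ)) * p q.1 q.2) := by
  have hn0 : (0 : ℝ) < n := by positivity
  have hn1 : (1 : ℝ) ≤ n := by exact_mod_cast (by omega : 1 ≤ n)
  set L := Real.logb 2 (n : ℝ) with hL
  have hL0 : 0 ≤ L := Real.logb_nonneg one_lt_two hn1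
  have hcard : ∑ _i : Fin n, (1 / (n : ℝ)) = 1 := by
    simp [hn0.ne']
  have hU : ent (fun i : Fin n => ∑ x, 1 / (n : ℝ) * p i x) = L := by
    simp only [ent, ← Finset.mul_sum, hp1, mul_one]
    simp [Real.logb_inv, hn0.ne', hL]
  let r : Fin n → 𝒳 → ℝ := fun i x => (if x ∈ S i then 1 / 2 else 0) + 1 / 2 * (1 / (n : ℝ))
  have hr : ∀ i x, 0 < r i x := fun i x => by
    dsimp only [r]
    split_ifs <;> positivity
  have hr1 : ∀ x, ∑ i, r i x ≤ 1 := by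
    intro x
    have hind : ∑ i, (if x ∈ S i then (1 / 2 : ℝ) else 0) ≤ 1 / 2 := by
      by_cases hx : ∃ j, x ∈ S j
      · obtain ⟨j, hj⟩ := hx
        rw [Finset.sum_eq_single j]
        · simp [hj]
        · intro i _ hij
          exact if_neg fun hi => Finset.disjoint_left.mp (hdisj i j hij) hi hj
        · simp
      · push Not at hx
        simp [hx]
    simp only [r, Finset.sum_add_distrib, ← Finset.mul_sum, hcard]
    linarith
  have hlogr : ∀ i x, -1 - L + (if x ∈ S i then L else 0) ≤ Real.logb 2 (r i x) := by
    intro i x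
    have hhalf : Real.logb 2 (1 / 2 : ℝ) = -1 := by
      rw [one_div, Real.logb_inv, Real.logb_self_eq_one one_lt_two]
    by_cases hx : x ∈ S i
    · have : Real.logb 2 (1 / 2 : ℝ) ≤ Real.logb 2 (r i x) :=
        Real.logb_le_logb_of_le one_lt_two (by norm_num) (by
          simp only [r, hx, if_true]
          have : 0 < 1 / 2 * (1 / (n : ℝ)) := by positivity
          linarith)
      simp only [hx, if_true]
      linarith
    · simp only [r, hx, if_false, zero_add, add_zero]
      rw [Real.logb_mul (by norm_num) (by positivity), hhalf, one_div, Real.logb_inv]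
      linarith
  have hrow : ∀ i, 1 / (n : ℝ) * (-1 - L / 2) ≤
      ∑ x, 1 / (n : ℝ) * p i x * Real.logb 2 (r i x) := by
    intro i
    simp only [mul_assoc, ← Finset.mul_sum]
    refine mul_le_mul_of_nonneg_left ?_ (by positivity)
    calc -1 - L / 2 ≤ (-1 - L) + (∑ x ∈ S i, p i x) * L := by nlinarith [hS i]
      _ = ∑ x, p i x * (-1 - L + (if x ∈ S i then L else 0)) := by
        simp only [mul_add, Finset.sum_add_distrib, ← Finset.sum_mul, hp1, one_mul, mul_ite,
          mul_zero, Finset.sum_ite_mem, Finset.univ_inter]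
      _ ≤ _ := Finset.sum_le_sum fun x _ => mul_le_mul_of_nonneg_left (hlogr i x) (hp0 i x)
  have hall : -1 - L / 2 ≤ ∑ i, ∑ x, 1 / (n : ℝ) * p i x * Real.logb 2 (r i x) := by
    have := Finset.sum_le_sum fun i (_ : i ∈ Finset.univ) => hrow i
    rwa [← Finset.sum_mul, hcard, one_mul] at this
  have hgibbs := sum_mul_logb_le_ent_sub_ent (fun q : Fin n × 𝒳 => 1 / (n : ℝ) * p q.1 q.2)
    (fun q => mul_nonneg (by positivity) (hp0 _ _)) r hr hr1
  rw [Real.logb_div hn0.ne' two_ne_zero, Real.logb_self_eq_one one_lt_two]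
  simp only [mutInfo, hU]
  linarith
end

section
/- Let n ≥ 1 and let Q be a 2^n × 2^n matrix whose entries Q_{ij} are probability distributions on [2^n]. Suppose Q is symmetric (Q_{ij} = Q_{ji}) and that for all i, j the support of Q_{ij} is contained in the interval [min{i,j}, max{i,j}]. Then there exist a row index r, distinct column indices k_1, …, k_{n+1} ∈ [2^n], and pairwise disjoint sets S_1, …, S_{n+1} ⊆ [2^n] such that Q_{r,k_t}(S_t) ≥ 1/2 for every t ∈ [n+1]. -/
/-- Row `r` has `m` entries, in distinct columns of `A`, that give mass at least `1/2` to
pairwise disjoint subsets of `A`. -/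
def HasSpreadRow {ι : Type*} (Q : ι → ι → ι → ℝ) (A : Finset ι) (m : ℕ) (r : ι) : Prop :=
  ∃ (k : Fin m → ι) (S : Fin m → Finset ι), Function.Injective k ∧ (∀ t, k t ∈ A) ∧
    (∀ t, S t ⊆ A) ∧ (∀ t u, t ≠ u → Disjoint (S t) (S u)) ∧
    ∀ t, (1 : ℝ) / 2 ≤ ∑ x ∈ S t, Q r (k t) x

theorem HasSpreadRow.extend {ι : Type*} {Q : ι → ι → ι → ℝ} {A B C : Finset ι} {m : ℕ} {r s : ι}
    (h : HasSpreadRow Q A m r) (hAB : Disjoint A B) (hAC : A ⊆ C) (hBC : B ⊆ C) (hs : s ∈ B)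
    (hmass : (1 : ℝ) / 2 ≤ ∑ x ∈ B, Q r s x) : HasSpreadRow Q C (m + 1) r := by
  obtain ⟨k, S, hk, hkA, hSA, hS, hm⟩ := h
  refine ⟨Fin.cons s k, Fin.cons B S, ?_, ?_, ?_, ?_, ?_⟩
  · refine Fin.cons_injective_iff.2 ⟨?_, hk⟩
    rintro ⟨t, rfl⟩
    exact Finset.disjoint_left.1 hAB (hkA t) hs
  · exact Fin.cases (hBC hs) fun t => hAC (hkA t)
  · exact Fin.cases hBC fun t => (hSA t).trans hAC
  · intro t u
    refine Fin.cases ?_ (fun t => ?_) t <;> refine Fin.cases ?_ (fun u => ?_) u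
    · exact fun h => absurd rfl h
    · exact fun _ => (hAB.mono_left (hSA u)).symm
    · exact fun _ => hAB.mono_left (hSA t)
    · exact fun h => hS t u fun e => h (congrArg Fin.succ e)
  · exact Fin.cases hmass hm

theorem sum_eq_one_of_support_subset {ι : Type*} [Fintype ι] [LinearOrder ι]
    {Q : ι → ι → ι → ℝ} (hQ0 : ∀ i j x, 0 ≤ Q i j x) (hQ1 : ∀ i j, ∑ x, Q i j x = 1)
    (hsupp : ∀ i j x, 0 < Q i j x → min i j ≤ x ∧ x ≤ max i j) {A : Finset ι}
    (hA : (A : Set ι).OrdConnected) {i j : ι} (hi : i ∈ A) (hj : j ∈ A) :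
    ∑ x ∈ A, Q i j x = 1 := by
  rw [← hQ1 i j]
  refine Finset.sum_subset (Finset.subset_univ A) fun x _ hx => ?_
  by_contra hne
  exact hx (hA.uIcc_subset hi hj (hsupp i j x (lt_of_le_of_ne (hQ0 i j x) (Ne.symm hne))))

/-- The indices in `[a, b)`. -/
def finBlock (N a b : ℕ) : Finset (Fin N) := {x | a ≤ (x : ℕ) ∧ (x : ℕ) < b}

theorem mem_finBlock {N a b : ℕ} {x : Fin N} : x ∈ finBlock N a b ↔ a ≤ (x : ℕ) ∧ (x : ℕ) < b := by
  simp [finBlock]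

theorem ordConnected_finBlock (N a b : ℕ) : (finBlock N a b : Set (Fin N)).OrdConnected := by
  refine ⟨fun x hx y hy z hz => ?_⟩
  simp only [Finset.mem_coe, mem_finBlock, Set.mem_Icc, Fin.le_def] at *
  omega

theorem exists_hasSpreadRow_finBlock {N : ℕ} {Q : Fin N → Fin N → Fin N → ℝ}
    (hQ0 : ∀ i j x, 0 ≤ Q i j x) (hQ1 : ∀ i j, ∑ x, Q i j x = 1)
    (hsym : ∀ i j, Q i j = Q j i)
    (hsupp : ∀ i j x, 0 < Q i j x → min i j ≤ x ∧ x ≤ max i j) (m : ℕ) :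
    ∀ a, a + 2 ^ m ≤ N →
      ∃ r ∈ finBlock N a (a + 2 ^ m), HasSpreadRow Q (finBlock N a (a + 2 ^ m)) (m + 1) r := by
  have hmass {a b : ℕ} {i j : Fin N} (hi : i ∈ finBlock N a b) (hj : j ∈ finBlock N a b) :=
    sum_eq_one_of_support_subset hQ0 hQ1 hsupp (ordConnected_finBlock N a b) hi hj
  induction m with
  | zero =>
    intro a ha
    have hr : (⟨a, by omega⟩ : Fin N) ∈ finBlock N a (a + 2 ^ 0) := by simp [mem_finBlock]
    refine ⟨_, hr, fun _ => _, fun _ => _, fun t u _ => Subsingleton.elim (α := Fin 1) t u,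
      fun _ => hr, fun _ => subset_rfl,
      fun t u h => absurd (Subsingleton.elim (α := Fin 1) t u) h, fun _ => ?_⟩
    rw [hmass hr hr]
    norm_num
  | succ m ih =>
    intro a ha
    rw [pow_succ] at ha ⊢
    obtain ⟨r, hr, hrow⟩ := ih a (by omega)
    obtain ⟨s, hs, hsrow⟩ := ih (a + 2 ^ m) (by omega)
    set L := finBlock N a (a + 2 ^ m)
    set R := finBlock N (a + 2 ^ m) (a + 2 ^ m + 2 ^ m)
    set C := finBlock N a (a + 2 ^ m * 2)
    have hLR : Disjoint L R := by
      refine Finset.disjoint_left.2 fun x hx hy => ?_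
      have := mem_finBlock.1 hx
      have := mem_finBlock.1 hy
      omega
    have hunion : L ∪ R = C := by
      ext x
      simp only [L, R, C, Finset.mem_union, mem_finBlock]
      omega
    have hLC : L ⊆ C := hunion ▸ Finset.subset_union_left
    have hRC : R ⊆ C := hunion ▸ Finset.subset_union_right
    have htotal : ∑ x ∈ L, Q r s x + ∑ x ∈ R, Q r s x = 1 := by
      rw [← Finset.sum_union hLR, hunion]
      exact hmass (hLC hr) (hRC hs)
    by_cases h : (1 : ℝ) / 2 ≤ ∑ x ∈ R, Q r s x
    · exact ⟨r, hLC hr, hrow.extend hLR hLC hRC hs h⟩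
    · refine ⟨s, hRC hs, hsrow.extend hLR.symm hRC hLC hr ?_⟩
      rw [hsym s r]
      linarith

open scoped Classical

/-- Let `Q` be a symmetric `2^n × 2^n` matrix whose entries are
probability distributions on `[2^n]`, such that the support of `Q_{ij}` is contained in
`[min{i,j}, max{i,j}]`. Then some row `r` contains `n+1` entries (in distinct columns
`k_1, …, k_{n+1}`) together with pairwise disjoint sets `S_1, …, S_{n+1}` such that
`Q_{r,k_t}(S_t) ≥ 1/2` for all `t`. -/
theorem stmt10 (n : ℕ) (hn : 1 ≤ n)
    (Q : Fin (2 ^ n) → Fin (2 ^ n) → Fin (2 ^ n) → ℝ)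
    (hQ0 : ∀ i j x, 0 ≤ Q i j x) (hQ1 : ∀ i j, ∑ x, Q i j x = 1)
    (hsym : ∀ i j, Q i j = Q j i)
    (hsupp : ∀ i j x, 0 < Q i j x → min i j ≤ x ∧ x ≤ max i j) :
    ∃ (r : Fin (2 ^ n)) (k : Fin (n + 1) → Fin (2 ^ n))
      (S : Fin (n + 1) → Finset (Fin (2 ^ n))),
        Function.Injective k ∧
        (∀ t u, t ≠ u → Disjoint (S t) (S u)) ∧
        ∀ t, (1 : ℝ) / 2 ≤ ∑ x ∈ S t, Q r (k t) x := by
  obtain ⟨r, -, k, S, hk, -, -, hS, hm⟩ :=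
    exists_hasSpreadRow_finBlock hQ0 hQ1 hsym hsupp n 0 (Nat.zero_add _).le
  exact ⟨r, k, S, hk, hS, hm⟩
end

section
/- Let N ≥ 4, X = [N], and let 𝒯 = {f_k : k ∈ [N]} be the class of thresholds, f_k(x) = 1 if x ≥ k and 0 otherwise. Let A_𝒯 be the generic learner for 𝒯: on a 𝒯-realizable sample S it outputs a uniformly random element of the set of thresholds with zero empirical error on S. Then for every sample size m and every distribution D on X × {0,1} realizable by 𝒯, with S ~ D^m, I(S; A_𝒯(S)) ≤ log₂ log₂ N + 2. -/
open scoped Classical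

/-- The threshold hypothesis `f_k` on `Fin N`: `f_k x = 1` iff `x ≥ k`. -/
def thr {N : ℕ} (k : Fin N) : Fin N → Bool := fun x => decide (k ≤ x)

/-- The conditional output distribution of the generic learner for thresholds over `[N]`:
given a sample `s`, it is uniform over the thresholds consistent with `s`. -/
noncomputable def genericThr (N m : ℕ) (s : Fin m → Fin N × Bool) : Fin N → ℝ :=
  fun k =>
    if (∀ i, thr k (s i).1 = (s i).2) then
      (1 / ((Finset.univ.filter
        (fun k' : Fin N => ∀ i, thr k' (s i).1 = (s i).2)).card : ℝ))
    else 0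

/-- Pointwise form of the Gibbs inequality. -/
theorem mul_logb_sub_logb_le {q r : ℝ} (hq : 0 ≤ q) (hr : 0 < r) :
    q * (Real.logb 2 r - Real.logb 2 q) ≤ (r - q) / Real.log 2 := by
  have hl : 0 < Real.log 2 := Real.log_pos (by norm_num)
  rcases hq.eq_or_lt with rfl | hq
  · simp only [zero_mul, sub_zero]
    positivity
  · rw [← Real.logb_div hr.ne' hq.ne', Real.logb, ← mul_div_assoc]
    gcongr
    calc q * Real.log (r / q) ≤ q * (r / q - 1) := by
          gcongr
          exact Real.log_le_sub_one_of_pos (by positivity)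
      _ = r - q := by field_simp

/-- If a joint distribution is dominated by `c` times the product of its first marginal and a
sub-probability weight `Q`, its mutual information is at most `log₂ c`. -/
theorem mutInfo_le_logb {α β : Type*} [Fintype α] [Fintype β] (μ : α × β → ℝ)
    (hμ0 : ∀ z, 0 ≤ μ z) (hμ1 : ∑ z, μ z = 1) (Q : β → ℝ) (hQ0 : ∀ b, 0 < Q b)
    (hQ1 : ∑ b, Q b ≤ 1) (c : ℝ) (hc : 0 < c)
    (hle : ∀ a b, μ (a, b) ≤ c * (∑ b', μ (a, b')) * Q b) :
    mutInfo μ ≤ Real.logb 2 c := by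
  set p : α → ℝ := fun a => ∑ b, μ (a, b)
  set q : β → ℝ := fun b => ∑ a, μ (a, b)
  have hl : 0 < Real.log 2 := Real.log_pos (by norm_num)
  have hq0 : ∀ b, 0 ≤ q b := fun b => Finset.sum_nonneg fun a _ => hμ0 _
  have hq1 : ∑ b, q b = 1 := by rw [← hμ1, Fintype.sum_prod_type_right]
  have hgibbs : ∑ b, q b * (Real.logb 2 (Q b) - Real.logb 2 (q b)) ≤ 0 := by
    calc _ ≤ ∑ b, (Q b - q b) / Real.log 2 :=
          Finset.sum_le_sum fun b _ => mul_logb_sub_logb_le (hq0 b) (hQ0 b)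
      _ = (∑ b, Q b - 1) / Real.log 2 := by
          rw [← Finset.sum_div, Finset.sum_sub_distrib, hq1]
      _ ≤ 0 := div_nonpos_of_nonpos_of_nonneg (by linarith) hl.le
  have hpoint : ∀ z : α × β, μ z * Real.logb 2 (μ z) ≤
      μ z * Real.logb 2 c + μ z * Real.logb 2 (p z.1) + μ z * Real.logb 2 (Q z.2) := by
    rintro ⟨a, b⟩
    rcases (hμ0 (a, b)).eq_or_lt with h | h
    · simp [← h]
    · have hpa : 0 < p a :=
        h.trans_le (Finset.single_le_sum (f := fun b => μ (a, b)) (fun b _ => hμ0 _)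
          (Finset.mem_univ b))
      have hlog := Real.logb_le_logb_of_le (b := 2) (by norm_num) h (hle a b)
      rw [Real.logb_mul (mul_pos hc hpa).ne' (hQ0 b).ne',
        Real.logb_mul hc.ne' hpa.ne'] at hlog
      simpa only [mul_add] using mul_le_mul_of_nonneg_left hlog h.le
  have hsum := Finset.sum_le_sum fun z (_ : z ∈ Finset.univ) => hpoint z
  have hfst : ∑ z : α × β, μ z * Real.logb 2 (p z.1) = ∑ a, p a * Real.logb 2 (p a) := by
    rw [Fintype.sum_prod_type]
    exact Finset.sum_congr rfl fun a _ => by simp only [p, Finset.sum_mul]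
  have hsnd : ∑ z : α × β, μ z * Real.logb 2 (Q z.2) = ∑ b, q b * Real.logb 2 (Q b) := by
    rw [Fintype.sum_prod_type_right]
    exact Finset.sum_congr rfl fun b _ => by simp only [q, Finset.sum_mul]
  rw [Finset.sum_add_distrib, Finset.sum_add_distrib, ← Finset.sum_mul, hμ1, hfst, hsnd] at hsum
  simp only [mul_sub, Finset.sum_sub_distrib] at hgibbs
  simp only [mutInfo, ent]
  linarith

/-- Distance between two indices. -/
def finGap {N : ℕ} (j k : Fin N) : ℕ := ((j : ℤ) - k).natAbs

theorem sum_inv_finGap_le {N : ℕ} (j : Fin N) :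
    ∑ k : Fin N, ((finGap j k : ℝ) + 1)⁻¹ ≤ 2 * (1 + Real.log N) := by
  have hside : ∀ s : Finset (Fin N), Set.InjOn (finGap j) s →
      ∑ k ∈ s, ((finGap j k : ℝ) + 1)⁻¹ ≤ 1 + Real.log N := by
    intro s hs
    rw [← Finset.sum_image (f := fun n : ℕ => ((n : ℝ) + 1)⁻¹) hs]
    calc _ ≤ ∑ n ∈ Finset.range N, ((n : ℝ) + 1)⁻¹ := by
          refine Finset.sum_le_sum_of_subset_of_nonneg ?_ fun n _ _ => by positivity
          intro n hn
          obtain ⟨k, -, rfl⟩ := Finset.mem_image.mp hn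
          rw [Finset.mem_range, finGap]
          omega
      _ = ((harmonic N : ℚ) : ℝ) := by simp [harmonic]
      _ ≤ _ := harmonic_le_one_add_log N
  rw [← Finset.sum_filter_add_sum_filter_not Finset.univ (fun k => k ≤ j), two_mul]
  refine add_le_add (hside _ ?_) (hside _ ?_)
  all_goals
    intro a ha b hb hab
    simp only [Finset.coe_filter, Finset.mem_univ, true_and, Set.mem_ofPred_eq] at ha hb
    simp only [finGap] at hab
    omega

/-- Thresholds between two consistent thresholds are consistent. -/
theorem finGap_lt_card_consistent {N m : ℕ} {s : Fin m → Fin N × Bool} {j k : Fin N}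
    (hj : ∀ i, thr j (s i).1 = (s i).2) (hk : ∀ i, thr k (s i).1 = (s i).2) :
    finGap j k + 1 ≤ (Finset.univ.filter
      (fun k' : Fin N => ∀ i, thr k' (s i).1 = (s i).2)).card := by
  calc finGap j k + 1 = (Finset.uIcc j k).card := by
        rw [Fin.card_uIcc, finGap, ← Int.natAbs_neg, neg_sub]
    _ ≤ _ := by
        refine Finset.card_le_card fun l hl => ?_
        rw [Finset.mem_filter]
        refine ⟨Finset.mem_univ _, fun i => ?_⟩
        rw [Finset.mem_uIcc] at hl
        have h1 := hj i
        have h2 := hk i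
        rw [← h1]
        rw [← h1] at h2
        simp only [thr, decide_eq_decide] at h2 ⊢
        rcases le_total j k with h | h
        · rw [inf_eq_left.mpr h, sup_eq_right.mpr h] at hl
          exact ⟨fun h' => hl.1.trans h', fun h' => hl.2.trans (h2.mpr h')⟩
        · rw [inf_eq_right.mpr h, sup_eq_left.mpr h] at hl
          exact ⟨fun h' => h2.mp (hl.1.trans h'), fun h' => hl.2.trans h'⟩

theorem genericThr_nonneg {N m : ℕ} (s : Fin m → Fin N × Bool) (k : Fin N) :
    0 ≤ genericThr N m s k := by
  unfold genericThr
  split_ifs <;> positivity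

theorem sum_genericThr {N m : ℕ} {s : Fin m → Fin N × Bool} {j : Fin N}
    (hj : ∀ i, thr j (s i).1 = (s i).2) : ∑ k, genericThr N m s k = 1 := by
  have h := finGap_lt_card_consistent hj hj
  simp only [genericThr]
  rw [← Finset.sum_filter, Finset.sum_const, nsmul_eq_mul]
  refine mul_one_div_cancel ?_
  exact_mod_cast (by omega : _ ≠ 0)

theorem genericThr_le_inv {N m : ℕ} {s : Fin m → Fin N × Bool} {j : Fin N}
    (hj : ∀ i, thr j (s i).1 = (s i).2) (k : Fin N) :
    genericThr N m s k ≤ ((finGap j k : ℝ) + 1)⁻¹ := by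
  unfold genericThr
  split_ifs with hk
  · rw [← one_div]
    have h := finGap_lt_card_consistent hj hk
    exact one_div_le_one_div_of_le (by positivity) (by exact_mod_cast h)
  · positivity

theorem eq_label_of_trueErr_eq_zero {X : Type*} [Fintype X] {D : X × Bool → ℝ}
    (hD0 : ∀ z, 0 ≤ D z) {h : X → Bool} (herr : trueErr D h = 0) {z : X × Bool}
    (hz : D z ≠ 0) : h z.1 = z.2 := by
  unfold trueErr at herr
  rw [Finset.sum_eq_zero_iff_of_nonneg
    fun z _ => mul_nonneg (hD0 z) (by split_ifs <;> norm_num)] at herr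
  simpa [hz] using herr z (Finset.mem_univ z)

/-- For the class of thresholds over `[N]` (`N ≥ 4`), every sample size
`m`, and every realizable distribution `D`, the generic learner (uniform over consistent
thresholds) has mutual information at most `log₂ log₂ N + 2` bits with `S ~ D^m`. -/
theorem stmt12 (N : ℕ) (hN : 4 ≤ N) (m : ℕ)
    (D : Fin N × Bool → ℝ) (hD0 : ∀ z, 0 ≤ D z) (hD1 : ∑ z, D z = 1)
    (hreal : ∃ k : Fin N, trueErr D (thr k) = 0) :
    mutInfo (fun p : (Fin m → Fin N × Bool) × Fin N =>
        (∏ i, D (p.1 i)) * genericThr N m p.1 p.2)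
      ≤ Real.logb 2 (Real.logb 2 N) + 2 := by
  obtain ⟨j, hj⟩ := hreal
  have hcons : ∀ s : Fin m → Fin N × Bool, ∏ i, D (s i) ≠ 0 →
      ∀ i, thr j (s i).1 = (s i).2 := fun s hs i =>
    eq_label_of_trueErr_eq_zero hD0 hj (Finset.prod_ne_zero_iff.mp hs i (Finset.mem_univ i))
  have hmarg : ∀ s : Fin m → Fin N × Bool,
      ∑ k, (∏ i, D (s i)) * genericThr N m s k = ∏ i, D (s i) := by
    intro s
    rw [← Finset.mul_sum]
    by_cases hs : ∏ i, D (s i) = 0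
    · rw [hs, zero_mul]
    · rw [sum_genericThr (hcons s hs), mul_one]
  have hN4 : (4 : ℝ) ≤ N := by exact_mod_cast hN
  have hL : 2 ≤ Real.logb 2 N := by
    rw [Real.le_logb_iff_rpow_le (by norm_num) (by linarith)]
    norm_num
    exact_mod_cast hN
  have hlog : Real.log N ≤ Real.logb 2 N :=
    le_div_self (Real.log_nonneg (by linarith)) (Real.log_pos (by norm_num))
      (by linarith [Real.log_two_lt_d9])
  have hc : 0 < 4 * Real.logb 2 N := by linarith
  have key := mutInfo_le_logb (fun p : (Fin m → Fin N × Bool) × Fin N =>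
      (∏ i, D (p.1 i)) * genericThr N m p.1 p.2)
    (fun p => mul_nonneg (Finset.prod_nonneg fun i _ => hD0 _) (genericThr_nonneg _ _))
    (by
      rw [Fintype.sum_prod_type]
      simp only [hmarg]
      rw [← Fintype.sum_pow, hD1, one_pow])
    (fun k => ((finGap j k : ℝ) + 1)⁻¹ / (4 * Real.logb 2 N))
    (fun k => by positivity)
    (by
      rw [← Finset.sum_div, div_le_one hc]
      linarith [sum_inv_finGap_le j])
    (4 * Real.logb 2 N) hc
    (by
      intro s k
      simp only [hmarg]
      by_cases hs : ∏ i, D (s i) = 0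
      · simp [hs]
      · calc _ ≤ (∏ i, D (s i)) * ((finGap j k : ℝ) + 1)⁻¹ :=
              mul_le_mul_of_nonneg_left (genericThr_le_inv (hcons s hs) k)
                (Finset.prod_nonneg fun i _ => hD0 _)
          _ = _ := by field_simp)
  rw [Real.logb_mul (by norm_num) (by linarith)] at key
  have h4 : Real.logb 2 4 = 2 := by
    rw [Real.logb_eq_iff_rpow_eq] <;> norm_num
  linarith
end

section
/- Let N ≥ 2, X = [N], and let 𝒫𝒻 = {f_i : i ∈ [N]} be the class of point functions, f_i(x) = 1 if x = i and 0 otherwise. Let A_𝒫𝒻 be the generic learner for 𝒫𝒻: on a realizable sample S it outputs a uniformly random element of the set of point functions with zero empirical error on S. Then for every distribution D on X × {0,1} realizable by 𝒫𝒻 and every sample size m ≤ N/2, with S ~ D^m, I(S; A_𝒫𝒻(S)) ≤ 2. -/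
open scoped Classical

/-- The point function `f_i` on `Fin N`: `f_i x = 1` iff `x = i`. -/
def pt {N : ℕ} (i : Fin N) : Fin N → Bool := fun x => decide (x = i)

/-- The conditional output distribution of the generic learner for point functions over
`[N]`: given a sample `s`, it is uniform over the point functions consistent with `s`. -/
noncomputable def genericPt (N m : ℕ) (s : Fin m → Fin N × Bool) : Fin N → ℝ :=
  fun i =>
    if (∀ j, pt i (s j).1 = (s j).2) then
      (1 / ((Finset.univ.filter
        (fun i' : Fin N => ∀ j, pt i' (s j).1 = (s j).2)).card : ℝ))
    else 0

/-- Gibbs' inequality: entropy is at most the cross entropy. -/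
lemma ent_le_crossEntropy {β : Type*} [Fintype β] (R Q : β → ℝ) (hR : ∀ b, 0 ≤ R b)
    (hQ : ∀ b, 0 < Q b) (hsum : ∑ b, Q b ≤ ∑ b, R b) :
    ent R ≤ - ∑ b, R b * Real.logb 2 (Q b) := by
  have hlog2 : 0 < Real.log 2 := Real.log_pos one_lt_two
  have key : ∀ b, R b * Real.logb 2 (Q b) - R b * Real.logb 2 (R b)
      ≤ (Q b - R b) / Real.log 2 := by
    intro b
    rcases (hR b).eq_or_lt with h | h
    · rw [← h]
      simpa using (div_pos (hQ b) hlog2).le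
    · have h1 := Real.log_le_sub_one_of_pos (div_pos (hQ b) h)
      rw [Real.log_div (hQ b).ne' h.ne'] at h1
      have h2 := mul_le_mul_of_nonneg_left h1 h.le
      have h3 : R b * (Q b / R b - 1) = Q b - R b := by field_simp
      rw [h3] at h2
      rw [Real.logb, Real.logb, ← mul_sub, ← sub_div, ← mul_div_assoc]
      gcongr
  have hs := Finset.sum_le_sum fun b (_ : b ∈ Finset.univ) => key b
  rw [Finset.sum_sub_distrib, ← Finset.sum_div, Finset.sum_sub_distrib] at hs
  have hle : (∑ b, Q b - ∑ b, R b) / Real.log 2 ≤ 0 :=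
    div_nonpos_of_nonpos_of_nonneg (by linarith) hlog2.le
  unfold ent
  linarith

/-- If a joint distribution is dominated by `c` times the product of its first marginal with a
fixed distribution `Q`, then its mutual information is at most `log₂ c`. -/
lemma mutInfo_le_logb_of_le_mul {α β : Type*} [Fintype α] [Fintype β] (μ : α × β → ℝ)
    (hμ0 : ∀ z, 0 ≤ μ z) (hμ1 : ∑ z, μ z = 1) (Q : β → ℝ) (hQ0 : ∀ b, 0 < Q b)
    (hQ1 : ∑ b, Q b = 1) (c : ℝ) (hc : 0 < c)
    (hle : ∀ a b, μ (a, b) ≤ c * ((∑ b', μ (a, b')) * Q b)) :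
    mutInfo μ ≤ Real.logb 2 c := by
  set P : α → ℝ := fun a => ∑ b, μ (a, b) with hP
  have hmarg : ∑ b, ∑ a, μ (a, b) = 1 := by
    rw [← hμ1, Fintype.sum_prod_type_right]
  have hgibbs := ent_le_crossEntropy (fun b => ∑ a, μ (a, b)) Q
    (fun b => Finset.sum_nonneg fun a _ => hμ0 _) hQ0 (by rw [hQ1, hmarg])
  have hcross : ∑ b, (∑ a, μ (a, b)) * Real.logb 2 (Q b) = ∑ z, μ z * Real.logb 2 (Q z.2) := by
    rw [Fintype.sum_prod_type_right]
    simp only [Finset.sum_mul]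
  have hfst : ∑ a, P a * Real.logb 2 (P a) = ∑ z, μ z * Real.logb 2 (P z.1) := by
    rw [Fintype.sum_prod_type]
    simp only [hP, Finset.sum_mul]
  have hpt : ∀ z, μ z * Real.logb 2 (μ z)
      ≤ μ z * Real.logb 2 c + (μ z * Real.logb 2 (P z.1) + μ z * Real.logb 2 (Q z.2)) := by
    rintro ⟨a, b⟩
    rcases (hμ0 (a, b)).eq_or_lt with h | h
    · simp [← h]
    · have hPa : 0 < P a :=
        h.trans_le (Finset.single_le_sum (f := fun b => μ (a, b)) (fun b _ => hμ0 _)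
          (Finset.mem_univ b))
      rw [← mul_add, ← mul_add, ← Real.logb_mul hPa.ne' (hQ0 b).ne',
        ← Real.logb_mul hc.ne' (mul_pos hPa (hQ0 b)).ne']
      exact mul_le_mul_of_nonneg_left
        (Real.logb_le_logb_of_le one_lt_two h (hle a b)) h.le
  have hs := Finset.sum_le_sum fun z (_ : z ∈ Finset.univ) => hpt z
  rw [Finset.sum_add_distrib, Finset.sum_add_distrib, ← Finset.sum_mul, hμ1, one_mul] at hs
  rw [hcross] at hgibbs
  have hP' : ent P = - ∑ z, μ z * Real.logb 2 (P z.1) := by rw [ent, hfst]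
  have hμ' : ent μ = - ∑ z, μ z * Real.logb 2 (μ z) := rfl
  unfold mutInfo
  linarith

lemma genericPt_nonneg (N m : ℕ) (s : Fin m → Fin N × Bool) (i : Fin N) :
    0 ≤ genericPt N m s i := by
  unfold genericPt
  split_ifs <;> positivity

/-- On a realizable sample the generic learner outputs a probability distribution. -/
lemma sum_genericPt (N m : ℕ) (s : Fin m → Fin N × Bool) (i₀ : Fin N)
    (h : ∀ j, pt i₀ (s j).1 = (s j).2) : ∑ i, genericPt N m s i = 1 := by
  unfold genericPt
  rw [← Finset.sum_filter, Finset.sum_const, nsmul_eq_mul]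
  refine mul_one_div_cancel ?_
  have : 0 < (Finset.univ.filter (fun i' : Fin N => ∀ j, pt i' (s j).1 = (s j).2)).card :=
    Finset.card_pos.2 ⟨i₀, by simpa using h⟩
  exact_mod_cast this.ne'

/-- On a sample consistent with `pt i₀`, every other point function is output with probability at
most `2 / N`. -/
lemma genericPt_le_of_ne (N m : ℕ) (hm : 2 * m ≤ N) (s : Fin m → Fin N × Bool) (i₀ i : Fin N)
    (h : ∀ j, pt i₀ (s j).1 = (s j).2) (hi : i ≠ i₀) : genericPt N m s i ≤ 2 / N := by
  unfold genericPt
  split_ifs with hc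
  · have hneg : ∀ j, (s j).2 = false := by
      intro j
      by_contra hj
      rw [Bool.not_eq_false] at hj
      have h1 := h j
      have h2 := hc j
      rw [hj] at h1 h2
      simp only [pt, decide_eq_true_eq] at h1 h2
      exact hi (h2.symm.trans h1)
    have hsub : (Finset.univ.image fun j => (s j).1)ᶜ ⊆
        Finset.univ.filter (fun i' : Fin N => ∀ j, pt i' (s j).1 = (s j).2) := by
      intro x hx
      rw [Finset.mem_compl] at hx
      rw [Finset.mem_filter]
      refine ⟨Finset.mem_univ _, fun j => ?_⟩
      rw [hneg j]
      simp only [pt, decide_eq_false_iff_not]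
      rintro rfl
      exact hx (Finset.mem_image_of_mem _ (Finset.mem_univ j))
    have hcard := Finset.card_le_card hsub
    rw [Finset.card_compl, Fintype.card_fin] at hcard
    have himg : (Finset.univ.image fun j => (s j).1).card ≤ m := by
      simpa using Finset.card_image_le (s := Finset.univ) (f := fun j => (s j).1)
    have hN : 0 < N := i.pos
    have hk : N ≤ 2 * (Finset.univ.filter
        (fun i' : Fin N => ∀ j, pt i' (s j).1 = (s j).2)).card := by omega
    have hk' : (N : ℝ) ≤ 2 * ((Finset.univ.filter
        (fun i' : Fin N => ∀ j, pt i' (s j).1 = (s j).2)).card : ℝ) := by exact_mod_cast hk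
    have hN' : (0 : ℝ) < N := by exact_mod_cast hN
    rw [div_le_div_iff₀ (by linarith) hN']
    linarith
  · positivity

lemma genericPt_le_one (N m : ℕ) (s : Fin m → Fin N × Bool) (i₀ i : Fin N)
    (h : ∀ j, pt i₀ (s j).1 = (s j).2) : genericPt N m s i ≤ 1 := by
  rw [← sum_genericPt N m s i₀ h]
  exact Finset.single_le_sum (fun i _ => genericPt_nonneg N m s i) (Finset.mem_univ i)

/-- Every sample of positive probability under a distribution with zero error for `h` is
consistent with `h`. -/
lemma consistent_of_prod_ne_zero {X : Type*} [Fintype X] {m : ℕ} (D : X × Bool → ℝ)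
    (hD0 : ∀ z, 0 ≤ D z) (h : X → Bool) (herr : trueErr D h = 0) (s : Fin m → X × Bool)
    (hs : ∏ j, D (s j) ≠ 0) (j : Fin m) : h (s j).1 = (s j).2 := by
  by_contra hj
  unfold trueErr at herr
  rw [Finset.sum_eq_zero_iff_of_nonneg
    (fun z _ => mul_nonneg (hD0 z) (by split_ifs <;> norm_num))] at herr
  have h0 := herr (s j) (Finset.mem_univ _)
  rw [if_pos hj, mul_one] at h0
  exact hs (Finset.prod_eq_zero (Finset.mem_univ j) h0)

/-- For the class of point functions over `[N]` (`N ≥ 2`), every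
realizable distribution `D`, and every sample size `m ≤ N/2`, the generic learner
(uniform over consistent point functions) has mutual information at most `2` bits with
`S ~ D^m`. -/
theorem stmt13 (N : ℕ) (hN : 2 ≤ N) (m : ℕ) (hm : 2 * m ≤ N)
    (D : Fin N × Bool → ℝ) (hD0 : ∀ z, 0 ≤ D z) (hD1 : ∑ z, D z = 1)
    (hreal : ∃ i : Fin N, trueErr D (pt i) = 0) :
    mutInfo (fun p : (Fin m → Fin N × Bool) × Fin N =>
        (∏ j, D (p.1 j)) * genericPt N m p.1 p.2) ≤ 2 := by
  obtain ⟨i₀, herr⟩ := hreal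
  have hNpos : (0 : ℝ) < N := by
    have : 0 < N := by omega
    exact_mod_cast this
  have hcons := consistent_of_prod_ne_zero (m := m) D hD0 (pt i₀) herr
  have hprod0 : ∀ s : Fin m → Fin N × Bool, 0 ≤ ∏ j, D (s j) :=
    fun s => Finset.prod_nonneg fun j _ => hD0 _
  have hrow : ∀ s : Fin m → Fin N × Bool,
      ∑ i, (∏ j, D (s j)) * genericPt N m s i = ∏ j, D (s j) := by
    intro s
    rw [← Finset.mul_sum]
    by_cases hs : ∏ j, D (s j) = 0
    · rw [hs, zero_mul]
    · rw [sum_genericPt N m s i₀ (hcons s hs), mul_one]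
  have hlog : Real.logb 2 4 = 2 := by
    rw [show (4 : ℝ) = 2 ^ (2 : ℕ) by norm_num, Real.logb_pow, Real.logb_self_eq_one one_lt_two]
    norm_num
  rw [← hlog]
  refine mutInfo_le_logb_of_le_mul _ (fun z => mul_nonneg (hprod0 _) (genericPt_nonneg _ _ _ _)) ?_
    (fun i => (if i = i₀ then 1 / 2 else 0) + 1 / (2 * N)) ?_ ?_ 4 (by norm_num) ?_
  · rw [Fintype.sum_prod_type]
    simp only [hrow]
    rw [← Fintype.prod_sum (fun (_ : Fin m) z => D z)]
    simp [hD1]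
  · intro i
    have : (0 : ℝ) < 1 / (2 * N) := by positivity
    split_ifs <;> linarith
  · rw [Finset.sum_add_distrib, Finset.sum_ite_eq', if_pos (Finset.mem_univ _), Finset.sum_const,
      Finset.card_univ, Fintype.card_fin, nsmul_eq_mul]
    field_simp
    norm_num
  · intro s i
    simp only [hrow]
    by_cases hs : ∏ j, D (s j) = 0
    · simp [hs]
    · rw [mul_left_comm]
      refine mul_le_mul_of_nonneg_left ?_ (hprod0 s)
      by_cases hi : i = i₀
      · have h1 := genericPt_le_one N m s i₀ i (hcons s hs)
        have : (0 : ℝ) < 1 / (2 * N) := by positivity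
        rw [if_pos hi]
        linarith
      · have h1 := genericPt_le_of_ne N m hm s i₀ i (hcons s hs) hi
        have : (4 : ℝ) * (0 + 1 / (2 * N)) = 2 / N := by field_simp; norm_num
        rw [if_neg hi, this]
        exact h1
end

section
/- There is a universal constant C > 0 such that the following holds. Let X be a finite domain, let D_X be a probability distribution on X, and let H ⊆ {0,1}^X be a hypothesis class of VC-dimension d ≥ 1. Then for every sample size m ≥ 1 there exists a deterministic function A mapping each H-realizable sample S ∈ (X × {0,1})^m to a hypothesis A(S) ∈ H with zero empirical error on S (i.e., A is consistent and proper), such that for every target h* ∈ H, if S consists of m i.i.d. points drawn from D_X each labeled by h*, then I(S; A(S)) = H(A(S)) ≤ C·d·log₂(m + 1). -/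
open scoped Classical

/-- `Y` is shattered by the hypothesis class `Hc` if every boolean pattern on `Y` is
realized by some hypothesis in `Hc`. -/
def Shatters {X : Type*} (Hc : Finset (X → Bool)) (Y : Finset X) : Prop :=
  ∀ b : X → Bool, ∃ h ∈ Hc, ∀ x ∈ Y, h x = b x

/-- A finite family of pairs of hypotheses, each pair disagreeing with probability at least `ε`,
is separated up to a `(1 - ε) ^ n` fraction by some set of at most `n` points. -/
theorem exists_separating_points {X : Type*} [Fintype X] [DecidableEq X] {D : X → ℝ}
    (hD : ∀ x, 0 ≤ D x) (hD1 : ∑ x, D x = 1) {ε : ℝ} (hε : ε ≤ 1)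
    (P : Finset ((X → Bool) × (X → Bool)))
    (hP : ∀ p ∈ P, ε ≤ ∑ x, if p.1 x ≠ p.2 x then D x else 0) (n : ℕ) :
    ∃ T : Finset X, T.card ≤ n ∧
      ((P.filter (fun p => ∀ x ∈ T, p.1 x = p.2 x)).card : ℝ) ≤ (1 - ε) ^ n * P.card := by
  induction n with
  | zero => exact ⟨∅, by simp⟩
  | succ n ih =>
    obtain ⟨T, hT, hTP⟩ := ih
    set Q := P.filter (fun p => ∀ x ∈ T, p.1 x = p.2 x) with hQ
    have key : ∃ x, ε * Q.card ≤ ((Q.filter (fun p => p.1 x ≠ p.2 x)).card : ℝ) := by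
      by_contra! hlt
      have hsum : ε * Q.card ≤ ∑ x, D x * ((Q.filter (fun p => p.1 x ≠ p.2 x)).card : ℝ) := by
        calc ε * Q.card = ∑ _p ∈ Q, ε := by simp [mul_comm]
          _ ≤ ∑ p ∈ Q, ∑ x, (if p.1 x ≠ p.2 x then D x else 0) :=
            Finset.sum_le_sum fun p hp => hP p (Finset.mem_filter.1 hp).1
          _ = _ := by
            rw [Finset.sum_comm]
            refine Finset.sum_congr rfl fun x _ => ?_
            rw [← Finset.sum_filter, Finset.sum_const, nsmul_eq_mul, mul_comm]
      have hex : ∃ x, 0 < D x := by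
        by_contra! h
        have : ∑ x, D x ≤ 0 := Finset.sum_nonpos fun x _ => h x
        linarith
      obtain ⟨x₀, hx₀⟩ := hex
      have : ∑ x, D x * ((Q.filter (fun p => p.1 x ≠ p.2 x)).card : ℝ)
          < ∑ x, D x * (ε * Q.card) :=
        Finset.sum_lt_sum (fun x _ => mul_le_mul_of_nonneg_left (hlt x).le (hD x))
          ⟨x₀, Finset.mem_univ _, mul_lt_mul_of_pos_left (hlt x₀) hx₀⟩
      rw [← Finset.sum_mul, hD1, one_mul] at this
      linarith
    obtain ⟨x, hx⟩ := key
    refine ⟨insert x T, (Finset.card_insert_le _ _).trans (by omega), ?_⟩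
    have hsplit := Finset.card_filter_add_card_filter_not (s := Q) (fun p => p.1 x ≠ p.2 x)
    have heq : P.filter (fun p => ∀ y ∈ insert x T, p.1 y = p.2 y)
        = Q.filter (fun p => ¬ p.1 x ≠ p.2 x) := by
      ext p
      simp only [hQ, Finset.mem_filter, Finset.mem_insert, forall_eq_or_imp, not_not]
      tauto
    rw [heq]
    have hsplit' : ((Q.filter (fun p => p.1 x ≠ p.2 x)).card : ℝ)
        + ((Q.filter (fun p => ¬ p.1 x ≠ p.2 x)).card : ℝ) = Q.card := by exact_mod_cast hsplit
    have : (1 - ε) * Q.card ≤ (1 - ε) * ((1 - ε) ^ n * P.card) :=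
      mul_le_mul_of_nonneg_left hTP (by linarith)
    rw [pow_succ]
    linarith

/-- Sauer–Shelah: a subclass separated by a finite set `T` is bounded by a binomial sum. -/
theorem card_le_sum_choose_of_injOn_restrict {X : Type*} [DecidableEq X]
    {Hc N : Finset (X → Bool)} {d : ℕ} (hN : N ⊆ Hc)
    (hvc : ∀ Y : Finset X, Shatters Hc Y → Y.card ≤ d) (T : Finset X)
    (hT : ∀ f ∈ N, ∀ g ∈ N, (∀ x ∈ T, f x = g x) → f = g) :
    N.card ≤ ∑ i ∈ Finset.range (d + 1), T.card.choose i := by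
  let tr : (X → Bool) → Finset X := fun h => T.filter (fun x => h x = true)
  have hinj : Set.InjOn tr N := by
    intro f hf g hg hfg
    refine hT f hf g hg fun x hx => ?_
    have : x ∈ tr f ↔ x ∈ tr g := by rw [hfg]
    simp only [tr, Finset.mem_filter, hx, true_and] at this
    exact Bool.eq_iff_iff.2 this
  rw [← Finset.card_image_of_injOn hinj]
  refine (Finset.card_le_card_shatterer _).trans ?_
  have hsub : (N.image tr).shatterer
      ⊆ (Finset.range (d + 1)).biUnion fun i => T.powersetCard i := by
    intro s hs
    rw [Finset.mem_shatterer] at hs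
    have hsT : s ⊆ T := by
      obtain ⟨u, hu, hsu⟩ := hs (Finset.Subset.refl s)
      obtain ⟨h, -, rfl⟩ := Finset.mem_image.1 hu
      exact (Finset.inter_eq_left.1 hsu).trans (Finset.filter_subset _ _)
    have hcard : s.card ≤ d := by
      refine hvc s fun b => ?_
      obtain ⟨u, hu, hsu⟩ := hs (Finset.filter_subset (fun x => b x = true) s)
      obtain ⟨h, hh, rfl⟩ := Finset.mem_image.1 hu
      refine ⟨h, hN hh, fun x hx => ?_⟩
      have : x ∈ s ∩ tr h ↔ x ∈ s.filter (fun x => b x = true) := by rw [hsu]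
      simp only [tr, Finset.mem_inter, Finset.mem_filter, hx, hsT hx, true_and] at this
      exact Bool.eq_iff_iff.2 this
    simp only [Finset.mem_biUnion, Finset.mem_range, Finset.mem_powersetCard]
    exact ⟨s.card, by omega, hsT, rfl⟩
  refine (Finset.card_le_card hsub).trans (Finset.card_biUnion_le.trans ?_)
  simp

/-- Chernoff-type bound on a truncated binomial sum. -/
theorem sum_choose_mul_pow_le_exp {x : ℝ} (hx0 : 0 ≤ x) (hx1 : x ≤ 1) (n d : ℕ) :
    ((∑ i ∈ Finset.range (d + 1), n.choose i : ℕ) : ℝ) * x ^ d ≤ Real.exp (n * x) := by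
  calc ((∑ i ∈ Finset.range (d + 1), n.choose i : ℕ) : ℝ) * x ^ d
      = ∑ i ∈ Finset.range (d + 1), (n.choose i : ℝ) * x ^ d := by
        push_cast; rw [Finset.sum_mul]
    _ ≤ ∑ i ∈ Finset.range (d + 1), (n.choose i : ℝ) * x ^ i := by
        refine Finset.sum_le_sum fun i hi => ?_
        refine mul_le_mul_of_nonneg_left ?_ (by positivity)
        exact pow_le_pow_of_le_one hx0 hx1 (by have := Finset.mem_range.1 hi; omega)
    _ ≤ ∑ i ∈ Finset.range (n + d + 1), (n.choose i : ℝ) * x ^ i :=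
        Finset.sum_le_sum_of_subset_of_nonneg
          (Finset.range_subset_range.2 (by omega)) fun i _ _ => by positivity
    _ = ∑ i ∈ Finset.range (n + 1), (n.choose i : ℝ) * x ^ i := by
        refine (Finset.sum_subset (Finset.range_subset_range.2 (by omega)) fun i _ hi => ?_).symm
        rw [Nat.choose_eq_zero_of_lt (by simpa using hi)]
        simp
    _ = (x + 1) ^ n := by
        rw [add_pow]
        exact Finset.sum_congr rfl fun i _ => by simp [mul_comm]
    _ ≤ Real.exp x ^ n := by gcongr; exact Real.add_one_le_exp x
    _ = Real.exp (n * x) := (Real.exp_nat_mul x n).symm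

/-- Packing bound: an `ε`-separated subclass of a class of VC-dimension at most `d` has at most
`(8 / ε) ^ (2 * d)` elements. -/
theorem card_le_of_separated {X : Type*} [Fintype X] [DecidableEq X] {D : X → ℝ}
    (hD : ∀ x, 0 ≤ D x) (hD1 : ∑ x, D x = 1) {Hc N : Finset (X → Bool)} {d : ℕ} (hd : 1 ≤ d)
    (hN : N ⊆ Hc) (hvc : ∀ Y : Finset X, Shatters Hc Y → Y.card ≤ d)
    {ε : ℝ} (hε0 : 0 < ε) (hε1 : ε ≤ 1)
    (hsep : ∀ f ∈ N, ∀ g ∈ N, f ≠ g → ε ≤ ∑ x, if f x ≠ g x then D x else 0) :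
    (N.card : ℝ) ≤ (8 / ε) ^ (2 * d) := by
  have h8 : 8 ≤ 8 / ε := by rw [le_div_iff₀ hε0]; linarith
  rcases N.eq_empty_or_nonempty with rfl | hne
  · simp only [Finset.card_empty, Nat.cast_zero]; positivity
  have hM : (1 : ℝ) ≤ N.card := by exact_mod_cast hne.card_pos
  set L := Real.log N.card with hL
  have hL0 : 0 ≤ L := Real.log_nonneg hM
  have hexpL : Real.exp L = N.card := Real.exp_log (by linarith)
  set n := ⌊2 * L / ε⌋₊ + 1 with hn
  have hn_lt : 2 * L / ε < n := by rw [hn]; push_cast; exact Nat.lt_floor_add_one _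
  have hn_le : (n : ℝ) ≤ 2 * L / ε + 1 := by
    rw [hn]; push_cast
    have := Nat.floor_le (a := 2 * L / ε) (by positivity)
    linarith
  obtain ⟨T, hTn, hT⟩ := exists_separating_points hD hD1 hε1 N.offDiag
    (fun p hp => by
      obtain ⟨h1, h2, h3⟩ := Finset.mem_offDiag.1 hp
      exact hsep _ h1 _ h2 h3) n
  have hsmall : (1 - ε) ^ n * (N.offDiag.card : ℝ) < 1 := by
    have h1 : (1 - ε) ^ n ≤ Real.exp (-(n * ε)) := by
      have := pow_le_pow_left₀ (by linarith) (Real.one_sub_le_exp_neg ε) n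
      rwa [← Real.exp_nat_mul, mul_neg] at this
    have h2 : (N.offDiag.card : ℝ) ≤ Real.exp (2 * L) := by
      rw [two_mul, Real.exp_add, hexpL, Finset.offDiag_card]
      exact_mod_cast Nat.sub_le _ _
    calc (1 - ε) ^ n * (N.offDiag.card : ℝ) ≤ Real.exp (-(n * ε)) * Real.exp (2 * L) := by gcongr
      _ = Real.exp (2 * L - n * ε) := by rw [← Real.exp_add]; ring_nf
      _ < 1 := by
        rw [Real.exp_lt_one_iff]
        rw [div_lt_iff₀ hε0] at hn_lt
        linarith
  have hsepT : ∀ f ∈ N, ∀ g ∈ N, (∀ x ∈ T, f x = g x) → f = g := by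
    intro f hf g hg hfg
    by_contra hne
    have h0 : (N.offDiag.filter (fun p => ∀ x ∈ T, p.1 x = p.2 x)).card < 1 := by
      exact_mod_cast hT.trans_lt hsmall
    have : (f, g) ∈ N.offDiag.filter (fun p => ∀ x ∈ T, p.1 x = p.2 x) :=
      Finset.mem_filter.2 ⟨Finset.mem_offDiag.2 ⟨hf, hg, hne⟩, hfg⟩
    have := Finset.card_pos.2 ⟨_, this⟩
    omega
  have hcard := card_le_sum_choose_of_injOn_restrict hN hvc T hsepT
  have hx := sum_choose_mul_pow_le_exp (x := ε / 8) (by positivity) (by linarith) T.card d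
  have hcard' : Real.exp L * (ε / 8) ^ d ≤ Real.exp (n * (ε / 8)) := by
    rw [hexpL]
    calc (N.card : ℝ) * (ε / 8) ^ d
        ≤ ((∑ i ∈ Finset.range (d + 1), T.card.choose i : ℕ) : ℝ) * (ε / 8) ^ d := by
          gcongr
      _ ≤ Real.exp (T.card * (ε / 8)) := hx
      _ ≤ Real.exp (n * (ε / 8)) := by gcongr
  have hlog : (ε / 8) = Real.exp (-Real.log (8 / ε)) := by
    rw [Real.exp_neg, Real.exp_log (by positivity), inv_div]
  have hL2 : L - d * Real.log (8 / ε) ≤ n * (ε / 8) := by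
    have := hcard'
    nth_rewrite 1 [hlog] at this
    rw [← Real.exp_nat_mul, ← Real.exp_add, Real.exp_le_exp] at this
    linarith
  have hn8 : n * (ε / 8) ≤ L / 4 + 1 / 8 := by
    calc n * (ε / 8) ≤ (2 * L / ε + 1) * (ε / 8) := by gcongr
      _ = L / 4 + ε / 8 := by field_simp; ring
      _ ≤ _ := by linarith
  have hlog1 : 1 ≤ Real.log (8 / ε) := by
    rw [Real.le_log_iff_exp_le (by positivity)]
    linarith [Real.exp_one_lt_d9]
  have hd' : (1 : ℝ) ≤ d := by exact_mod_cast hd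
  have hfin : L ≤ (2 * d : ℕ) * Real.log (8 / ε) := by
    push_cast
    nlinarith
  calc (N.card : ℝ) = Real.exp L := hexpL.symm
    _ ≤ Real.exp ((2 * d : ℕ) * Real.log (8 / ε)) := by gcongr
    _ = (8 / ε) ^ (2 * d) := by rw [Real.exp_nat_mul, Real.exp_log (by positivity)]

/-- Every class of VC-dimension at most `d` has a proper `ε`-cover of size at most
`(8 / ε) ^ (2 * d)`. -/
theorem exists_cover {X : Type*} [Fintype X] [DecidableEq X] {D : X → ℝ}
    (hD : ∀ x, 0 ≤ D x) (hD1 : ∑ x, D x = 1) {Hc : Finset (X → Bool)} {d : ℕ} (hd : 1 ≤ d)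
    (hvc : ∀ Y : Finset X, Shatters Hc Y → Y.card ≤ d) {ε : ℝ} (hε0 : 0 < ε) (hε1 : ε ≤ 1) :
    ∃ N ⊆ Hc, (N.card : ℝ) ≤ (8 / ε) ^ (2 * d) ∧
      ∀ h ∈ Hc, ∃ g ∈ N, (∑ x, if g x ≠ h x then D x else 0) ≤ ε := by
  let Sep : Finset (X → Bool) → Prop := fun N =>
    ∀ f ∈ N, ∀ g ∈ N, f ≠ g → ε ≤ ∑ x, if f x ≠ g x then D x else 0
  obtain ⟨N, hN, hmax⟩ := Finset.exists_max_image (Hc.powerset.filter Sep) Finset.card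
    ⟨∅, by simp [Sep]⟩
  obtain ⟨hNH, hNsep⟩ := Finset.mem_filter.1 hN
  rw [Finset.mem_powerset] at hNH
  refine ⟨N, hNH, card_le_of_separated hD hD1 hd hNH hvc hε0 hε1 hNsep, fun h hh => ?_⟩
  by_contra! hfar
  have hhN : h ∉ N := fun hmem => by
    have := hfar h hmem
    simp at this
    linarith
  have hins : insert h N ∈ Hc.powerset.filter Sep := by
    refine Finset.mem_filter.2 ⟨Finset.mem_powerset.2 (Finset.insert_subset hh hNH), ?_⟩
    intro f hf g hg hfg
    rcases Finset.mem_insert.1 hf with rfl | hf' <;> rcases Finset.mem_insert.1 hg with rfl | hg'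
    · exact absurd rfl hfg
    · simpa only [ne_comm] using (hfar g hg').le
    · exact (hfar f hf').le
    · exact hNsep f hf' g hg' hfg
  have := hmax _ hins
  rw [Finset.card_insert_of_notMem hhN] at this
  omega

/-- Gibbs' inequality with a subprobability weight `(W a)⁻¹`. -/
theorem ent_le_sum_mul_logb {α : Type*} [Fintype α] {p W : α → ℝ} (s : Finset α)
    (hp : ∀ a, 0 ≤ p a) (hp1 : ∑ a, p a = 1) (hps : ∀ a ∉ s, p a = 0)
    (hW : ∀ a, 0 < W a) (hWs : ∑ a ∈ s, (W a)⁻¹ ≤ 1) :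
    ent p ≤ ∑ a, p a * Real.logb 2 (W a) := by
  have hl2 : 0 < Real.log 2 := Real.log_pos one_lt_two
  have hterm : ∀ a, -(p a * Real.log (p a)) ≤ p a * Real.log (W a) + ((W a)⁻¹ - p a) := by
    intro a
    have hWi : 0 < (W a)⁻¹ := inv_pos.2 (hW a)
    rcases (hp a).eq_or_lt with h0 | hpos
    · simp [← h0, (hW a).le]
    · have h := Real.log_le_sub_one_of_pos (x := (W a)⁻¹ / p a) (by positivity)
      rw [Real.log_div hWi.ne' hpos.ne', Real.log_inv] at h
      have h' := mul_le_mul_of_nonneg_left h hpos.le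
      have : p a * ((W a)⁻¹ / p a - 1) = (W a)⁻¹ - p a := by field_simp
      rw [this] at h'
      linarith
  have hp1s : ∑ a ∈ s, p a = 1 := by
    rw [← hp1]
    exact Finset.sum_subset (Finset.subset_univ _) fun a _ ha => hps a ha
  have hnat : -∑ a, p a * Real.log (p a) ≤ ∑ a, p a * Real.log (W a) := by
    have e1 : ∑ a ∈ s, p a * Real.log (p a) = ∑ a, p a * Real.log (p a) :=
      Finset.sum_subset (Finset.subset_univ _) fun a _ ha => by simp [hps a ha]
    have e2 : ∑ a ∈ s, p a * Real.log (W a) = ∑ a, p a * Real.log (W a) :=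
      Finset.sum_subset (Finset.subset_univ _) fun a _ ha => by simp [hps a ha]
    have := Finset.sum_le_sum fun a (_ : a ∈ s) => hterm a
    rw [Finset.sum_neg_distrib, Finset.sum_add_distrib, Finset.sum_sub_distrib, hp1s, e1, e2]
      at this
    linarith
  unfold ent
  simp only [Real.logb, ← mul_div_assoc, ← Finset.sum_div]
  rw [← neg_div]
  gcongr

/-- The product weights of a probability vector sum to one. -/
theorem sum_prod_eq_one {X : Type*} [Fintype X] {D : X → ℝ} (hD1 : ∑ x, D x = 1) (m : ℕ) :
    ∑ xs : Fin m → X, ∏ i, D (xs i) = 1 := by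
  rw [← Fintype.sum_pow, hD1, one_pow]

/-- Union bound: an i.i.d. sample hits an event of probability at most `ε` with probability at
most `m * ε`. -/
theorem sum_prod_exists_le {X : Type*} [Fintype X] {D : X → ℝ} (hD : ∀ x, 0 ≤ D x)
    (hD1 : ∑ x, D x = 1) (m : ℕ) (B : X → Prop) {ε : ℝ}
    (hB : (∑ x, if B x then D x else 0) ≤ ε) :
    (∑ xs : Fin m → X, if ∃ i, B (xs i) then ∏ i, D (xs i) else 0) ≤ m * ε := by
  have hone : ∀ i : Fin m, (∑ xs : Fin m → X, if B (xs i) then ∏ j, D (xs j) else 0)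
      = ∑ x, if B x then D x else 0 := by
    intro i
    have h := Finset.prod_univ_sum (fun _ : Fin m => (Finset.univ : Finset X))
      (fun j x => if j = i then (if B x then D x else 0) else D x)
    rw [Fintype.piFinset_univ] at h
    have hl : (∏ j : Fin m, ∑ x, if j = i then (if B x then D x else 0) else D x)
        = ∑ x, if B x then D x else 0 := by
      rw [Finset.prod_eq_single i (fun j _ hj => by simp [hj, hD1]) (by simp)]
      simp
    rw [← hl, h]
    refine Finset.sum_congr rfl fun xs _ => ?_
    split_ifs with hx
    · refine Finset.prod_congr rfl fun j _ => ?_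
      split_ifs with hj hb
      · rfl
      · subst hj; exact absurd hx hb
      · rfl
    · exact (Finset.prod_eq_zero (Finset.mem_univ i) (by simp [hx])).symm
  calc (∑ xs : Fin m → X, if ∃ i, B (xs i) then ∏ i, D (xs i) else 0)
      ≤ ∑ xs : Fin m → X, ∑ i, if B (xs i) then ∏ j, D (xs j) else 0 := by
        refine Finset.sum_le_sum fun xs _ => ?_
        have hnn : 0 ≤ ∏ j, D (xs j) := Finset.prod_nonneg fun j _ => hD _
        have hterm : ∀ i ∈ Finset.univ, 0 ≤ if B (xs i) then ∏ j, D (xs j) else 0 := by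
          intro i _
          split_ifs <;> simp [hnn]
        split_ifs with hex
        · obtain ⟨i, hi⟩ := hex
          have := Finset.single_le_sum hterm (Finset.mem_univ i)
          simpa [hi] using this
        · exact Finset.sum_nonneg hterm
    _ = ∑ i : Fin m, ∑ x, if B x then D x else 0 := by
        rw [Finset.sum_comm]
        exact Finset.sum_congr rfl fun i _ => hone i
    _ ≤ m * ε := by
        rw [Finset.sum_const, Finset.card_univ, Fintype.card_fin, nsmul_eq_mul]
        gcongr

/-- Covers at geometrically decreasing scales, assembled into a level function whose sublevel sets
contain covers and whose associated weights satisfy Kraft's inequality. -/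
theorem exists_level {X : Type*} [Fintype X] [DecidableEq X] {D : X → ℝ}
    (hD : ∀ x, 0 ≤ D x) (hD1 : ∑ x, D x = 1) {Hc : Finset (X → Bool)} {d : ℕ} (hd : 1 ≤ d)
    (hvc : ∀ Y : Finset X, Shatters Hc Y → Y.card ≤ d) {c : ℝ} (hc : 1 ≤ c) :
    ∃ (K : ℕ) (lvl : (X → Bool) → ℕ), (∀ g, lvl g ≤ K) ∧
      (∑ g ∈ Hc, ((2 : ℝ) ^ (lvl g + 1) * (8 * (2 ^ lvl g * c)) ^ (2 * d))⁻¹ ≤ 1) ∧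
      ∀ k, ∀ h ∈ Hc, ∃ g ∈ Hc, lvl g ≤ k ∧
        (∑ x, if g x ≠ h x then D x else 0) ≤ (2 ^ k * c)⁻¹ := by
  have hbase : ∀ k : ℕ, 1 ≤ 2 ^ k * c := fun k =>
    one_le_mul_of_one_le_of_one_le (one_le_pow₀ one_le_two) hc
  obtain ⟨K, hK⟩ := pow_unbounded_of_one_lt (Hc.card : ℝ) one_lt_two
  have hKcard : (Hc.card : ℝ) ≤ (8 * (2 ^ K * c)) ^ (2 * d) := by
    calc (Hc.card : ℝ) ≤ 2 ^ K := hK.le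
      _ ≤ 8 * (2 ^ K * c) := by
        have : (0 : ℝ) < 2 ^ K := by positivity
        nlinarith
      _ ≤ (8 * (2 ^ K * c)) ^ (2 * d) :=
        le_self_pow₀ (by linarith [hbase K]) (by omega)
  have hcov : ∀ k, ∃ N ⊆ Hc, (N.card : ℝ) ≤ (8 * (2 ^ k * c)) ^ (2 * d) ∧
      ∀ h ∈ Hc, ∃ g ∈ N, (∑ x, if g x ≠ h x then D x else 0) ≤ (2 ^ k * c)⁻¹ := by
    intro k
    have h := exists_cover hD hD1 hd hvc (ε := (2 ^ k * c)⁻¹)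
      (inv_pos.2 (by linarith [hbase k])) (inv_le_one_of_one_le₀ (hbase k))
    simpa only [div_inv_eq_mul] using h
  choose N hNH hNcard hNcov using hcov
  have hex : ∀ g, ∃ k, g ∈ N k ∨ K ≤ k := fun g => ⟨K, Or.inr le_rfl⟩
  let lvl : (X → Bool) → ℕ := fun g => Nat.find (hex g)
  have hlvlK : ∀ g, lvl g ≤ K := fun g => Nat.find_min' (hex g) (Or.inr le_rfl)
  have hfiber : ∀ k, ((Hc.filter fun g => lvl g = k).card : ℝ) ≤ (8 * (2 ^ k * c)) ^ (2 * d) := by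
    intro k
    rcases eq_or_ne k K with rfl | hk
    · exact le_trans (by exact_mod_cast Finset.card_filter_le _ _) hKcard
    · refine le_trans ?_ (hNcard k)
      refine Nat.cast_le.2 (Finset.card_le_card fun g hg => ?_)
      have hgk := (Finset.mem_filter.1 hg).2
      rcases Nat.find_spec (hex g) with h | h
      · rwa [← hgk]
      · exact absurd (le_antisymm (hlvlK g) h) (hgk.trans_ne hk)
  refine ⟨K, lvl, hlvlK, ?_, fun k h hh => ?_⟩
  · have hgeo : ∑ k ∈ Finset.range (K + 1), ((2 : ℝ) ^ (k + 1))⁻¹ ≤ 1 := by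
      have : ∀ n : ℕ, ∑ k ∈ Finset.range n, ((2 : ℝ) ^ (k + 1))⁻¹ = 1 - (2 ^ n)⁻¹ := by
        intro n
        induction n with
        | zero => simp
        | succ n ih => rw [Finset.sum_range_succ, ih, pow_succ]; field_simp; ring
      rw [this]
      have : (0 : ℝ) < (2 ^ (K + 1))⁻¹ := by positivity
      linarith
    refine le_trans ?_ hgeo
    rw [← Finset.sum_fiberwise_of_maps_to (s := Hc) (t := Finset.range (K + 1)) (g := lvl)
      (fun g _ => Finset.mem_range.2 (Nat.lt_succ_of_le (hlvlK g)))]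
    refine Finset.sum_le_sum fun k _ => ?_
    have hpos : (0 : ℝ) < (8 * (2 ^ k * c)) ^ (2 * d) := by
      have := hbase k
      positivity
    calc ∑ g ∈ Hc.filter (fun g => lvl g = k),
          ((2 : ℝ) ^ (lvl g + 1) * (8 * (2 ^ lvl g * c)) ^ (2 * d))⁻¹
        = ∑ _g ∈ Hc.filter (fun g => lvl g = k),
          ((2 : ℝ) ^ (k + 1) * (8 * (2 ^ k * c)) ^ (2 * d))⁻¹ :=
          Finset.sum_congr rfl fun g hg => by rw [(Finset.mem_filter.1 hg).2]
      _ = (Hc.filter fun g => lvl g = k).card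
          * ((2 : ℝ) ^ (k + 1) * (8 * (2 ^ k * c)) ^ (2 * d))⁻¹ := by
          rw [Finset.sum_const, nsmul_eq_mul]
      _ ≤ (8 * (2 ^ k * c)) ^ (2 * d)
          * ((2 : ℝ) ^ (k + 1) * (8 * (2 ^ k * c)) ^ (2 * d))⁻¹ := by
          gcongr
          exact hfiber k
      _ = ((2 : ℝ) ^ (k + 1))⁻¹ := by field_simp
  · obtain ⟨g, hg, hgh⟩ := hNcov k h hh
    exact ⟨g, hNH k hg, Nat.find_min' (hex g) (Or.inl hg), hgh⟩

/-- Layer-cake bound: a bounded level with tails `P (ℓ > k) ≤ 2 ^ (-k)` has mean at most `2`. -/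
theorem sum_mul_level_le_two {Ω : Type*} [Fintype Ω] {w : Ω → ℝ}
    {K : ℕ} {ℓ : Ω → ℕ} (hK : ∀ o, ℓ o ≤ K)
    (htail : ∀ k, (∑ o, if k < ℓ o then w o else 0) ≤ ((2 : ℝ) ^ k)⁻¹) :
    ∑ o, w o * ℓ o ≤ 2 := by
  calc ∑ o, w o * ℓ o = ∑ o, ∑ k ∈ Finset.range K, if k < ℓ o then w o else 0 := by
        refine Finset.sum_congr rfl fun o _ => ?_
        have : (Finset.range K).filter (fun k => k < ℓ o) = Finset.range (ℓ o) := by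
          ext k
          have := hK o
          simp only [Finset.mem_filter, Finset.mem_range]
          omega
        rw [← Finset.sum_filter, this, Finset.sum_const, Finset.card_range, nsmul_eq_mul, mul_comm]
    _ = ∑ k ∈ Finset.range K, ∑ o, if k < ℓ o then w o else 0 := Finset.sum_comm
    _ ≤ ∑ k ∈ Finset.range K, ((2 : ℝ) ^ k)⁻¹ := Finset.sum_le_sum fun k _ => htail k
    _ = 2 - 2 * ((2 : ℝ) ^ K)⁻¹ := by
        clear htail hK
        induction K with
        | zero => simp
        | succ n ih => rw [Finset.sum_range_succ, ih, pow_succ]; field_simp; ring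
    _ ≤ 2 := by
        have : (0 : ℝ) < ((2 : ℝ) ^ K)⁻¹ := by positivity
        linarith

/-- Cross-entropy bound for the image of a weight function under a map `a`. -/
theorem ent_image_le {Ω α : Type*} [Fintype Ω] [Fintype α] [DecidableEq α] {w : Ω → ℝ}
    (hw : ∀ o, 0 ≤ w o) (hw1 : ∑ o, w o = 1) (a : Ω → α) (s : Finset α) (has : ∀ o, a o ∈ s) {W : α → ℝ}
    (hW : ∀ g, 0 < W g) (hWs : ∑ g ∈ s, (W g)⁻¹ ≤ 1) :
    ent (fun g => ∑ o ∈ Finset.univ.filter (fun o => a o = g), w o)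
      ≤ ∑ o, w o * Real.logb 2 (W (a o)) := by
  refine (ent_le_sum_mul_logb s (fun g => Finset.sum_nonneg fun o _ => hw o) ?_ ?_ hW hWs).trans ?_
  · rw [Finset.sum_fiberwise, hw1]
  · intro g hg
    refine Finset.sum_eq_zero fun o ho => ?_
    exact absurd ((Finset.mem_filter.1 ho).2 ▸ has o) hg
  · rw [← Finset.sum_fiberwise Finset.univ a]
    refine (Finset.sum_congr rfl fun g _ => ?_).le
    rw [Finset.sum_mul]
    exact Finset.sum_congr rfl fun o ho => by rw [(Finset.mem_filter.1 ho).2]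

/-- The learner that outputs a consistent hypothesis of least level has output entropy
`O(d log (m + 1))`. -/
theorem exists_consistent_learner {X : Type*} [Fintype X] [DecidableEq X] {D : X → ℝ}
    (hD : ∀ x, 0 ≤ D x) (hD1 : ∑ x, D x = 1) {Hc : Finset (X → Bool)} {d : ℕ} (hd : 1 ≤ d)
    (hvc : ∀ Y : Finset X, Shatters Hc Y → Y.card ≤ d) {m : ℕ} (hm : 1 ≤ m) :
    ∃ A : (Fin m → X × Bool) → (X → Bool),
      (∀ S : Fin m → X × Bool, (∃ h ∈ Hc, ∀ i, h (S i).1 = (S i).2) →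
        A S ∈ Hc ∧ ∀ i, (A S) (S i).1 = (S i).2) ∧
      ∀ h' ∈ Hc,
        ent (fun g : X → Bool => ∑ xs ∈ Finset.univ.filter
            (fun xs : Fin m → X => A (fun i => (xs i, h' (xs i))) = g), ∏ i, D (xs i))
          ≤ 17 * d * Real.logb 2 ((m : ℝ) + 1) := by
  have hm1 : (1 : ℝ) ≤ m := by exact_mod_cast hm
  have hd1 : (1 : ℝ) ≤ d := by exact_mod_cast hd
  obtain ⟨K, lvl, hlK, hkraft, hcov⟩ := exists_level hD hD1 hd hvc (c := ((m : ℝ) + 1) ^ 2)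
    (one_le_pow₀ (by linarith))
  have hA : ∀ S : Fin m → X × Bool, ∃ f : X → Bool, (∃ h ∈ Hc, ∀ i, h (S i).1 = (S i).2) →
      (f ∈ Hc ∧ ∀ i, f (S i).1 = (S i).2) ∧
        ∀ h ∈ Hc, (∀ i, h (S i).1 = (S i).2) → lvl f ≤ lvl h := by
    intro S
    by_cases hS : ∃ h ∈ Hc, ∀ i, h (S i).1 = (S i).2
    · obtain ⟨h, hh, hhS⟩ := hS
      obtain ⟨f, hf, hmin⟩ := Finset.exists_min_image
        (Hc.filter fun h => ∀ i, h (S i).1 = (S i).2) lvl ⟨h, Finset.mem_filter.2 ⟨hh, hhS⟩⟩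
      exact ⟨f, fun _ => ⟨Finset.mem_filter.1 hf,
        fun g hg hgS => hmin g (Finset.mem_filter.2 ⟨hg, hgS⟩)⟩⟩
    · exact ⟨fun _ => false, fun h => absurd h hS⟩
  choose A hA using hA
  refine ⟨A, fun S hS => (hA S hS).1, fun h' hh' => ?_⟩
  set a : (Fin m → X) → (X → Bool) := fun xs => A (fun i => (xs i, h' (xs i))) with ha
  have haA : ∀ xs, a xs ∈ Hc ∧ ∀ h ∈ Hc, (∀ i, h (xs i) = h' (xs i)) → lvl (a xs) ≤ lvl h := by
    intro xs
    have := hA (fun i => (xs i, h' (xs i))) ⟨h', hh', fun i => rfl⟩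
    exact ⟨this.1.1, this.2⟩
  have hw : ∀ xs : Fin m → X, 0 ≤ ∏ i, D (xs i) := fun xs => Finset.prod_nonneg fun i _ => hD _
  have hw1 := sum_prod_eq_one hD1 m
  refine (ent_image_le hw hw1 a Hc (fun xs => (haA xs).1)
    (W := fun g => (2 : ℝ) ^ (lvl g + 1) * (8 * (2 ^ lvl g * ((m : ℝ) + 1) ^ 2)) ^ (2 * d))
    (fun g => by positivity) hkraft).trans ?_
  have hmean : ∑ xs : Fin m → X, (∏ i, D (xs i)) * (lvl (a xs) : ℝ) ≤ 2 := by
    refine sum_mul_level_le_two (fun xs => hlK _) fun k => ?_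
    obtain ⟨g, hg, hgk, hgh⟩ := hcov k h' hh'
    calc (∑ xs : Fin m → X, if k < lvl (a xs) then ∏ i, D (xs i) else 0)
        ≤ ∑ xs : Fin m → X, if ∃ i, g (xs i) ≠ h' (xs i) then ∏ i, D (xs i) else 0 := by
          refine Finset.sum_le_sum fun xs _ => ?_
          split_ifs with h1 h2 h2
          · exact le_rfl
          · push Not at h2
            exact absurd ((haA xs).2 g hg h2) (by omega)
          · exact hw xs
          · exact le_rfl
      _ ≤ m * (2 ^ k * ((m : ℝ) + 1) ^ 2)⁻¹ := by
          have := sum_prod_exists_le hD hD1 m (fun x => g x ≠ h' x)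
            (ε := (2 ^ k * ((m : ℝ) + 1) ^ 2)⁻¹) (by convert hgh)
          convert this
      _ ≤ ((2 : ℝ) ^ k)⁻¹ := by
          rw [mul_inv, mul_left_comm]
          refine mul_le_of_le_one_right (by positivity) ?_
          rw [← div_eq_mul_inv, div_le_one (by positivity)]
          nlinarith
  set L := Real.logb 2 ((m : ℝ) + 1) with hL
  have hL1 : 1 ≤ L := by
    rw [hL, Real.le_logb_iff_rpow_le one_lt_two (by linarith)]
    norm_num
    linarith
  have hlog : ∀ k : ℕ, Real.logb 2 ((2 : ℝ) ^ (k + 1) * (8 * (2 ^ k * ((m : ℝ) + 1) ^ 2)) ^ (2 * d))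
      = (1 + 2 * d) * k + (1 + 2 * d * (3 + 2 * L)) := by
    intro k
    have h8 : Real.logb 2 8 = 3 := by
      rw [show (8 : ℝ) = 2 ^ 3 by norm_num, Real.logb_pow, Real.logb_self_eq_one one_lt_two]
      norm_num
    rw [Real.logb_mul (by positivity) (by positivity), Real.logb_pow, Real.logb_pow,
      Real.logb_mul (by positivity) (by positivity), Real.logb_mul (by positivity) (by positivity),
      Real.logb_pow, Real.logb_pow, h8, Real.logb_self_eq_one one_lt_two]
    push_cast
    ring
  simp only [hlog]
  calc ∑ xs : Fin m → X, (∏ i, D (xs i)) *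
        ((1 + 2 * d) * (lvl (a xs) : ℝ) + (1 + 2 * d * (3 + 2 * L)))
      = (1 + 2 * d) * (∑ xs : Fin m → X, (∏ i, D (xs i)) * (lvl (a xs) : ℝ))
        + (1 + 2 * d * (3 + 2 * L)) * ∑ xs : Fin m → X, ∏ i, D (xs i) := by
        rw [Finset.mul_sum, Finset.mul_sum, ← Finset.sum_add_distrib]
        exact Finset.sum_congr rfl fun xs _ => by ring
    _ ≤ (1 + 2 * d) * 2 + (1 + 2 * d * (3 + 2 * L)) * 1 := by
        rw [hw1]
        gcongr
    _ ≤ 17 * d * L := by nlinarith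

/-- **distribution-dependent setting.** There is a universal constant
`C > 0` such that for every finite domain `X`, distribution `D_X` on `X`, hypothesis class
`Hc ⊆ {0,1}^X` of VC-dimension exactly `d ≥ 1`, and sample size `m ≥ 1`, there is a
deterministic, consistent and proper learner `A` (on `Hc`-realizable samples) whose
output entropy — equal to `I(S; A(S))` since `A` is deterministic — is at most
`C·d·log₂(m+1)` when `S` consists of `m` i.i.d. `D_X`-points labeled by any `h* ∈ Hc`. -/
theorem stmt14 :
    ∃ C : ℝ, 0 < C ∧
      ∀ (X : Type) (_ : Fintype X) (_ : DecidableEq X) (DX : X → ℝ),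
        (∀ x, 0 ≤ DX x) → (∑ x, DX x = 1) →
        ∀ (Hc : Finset (X → Bool)) (d : ℕ), 1 ≤ d →
        (∃ Y : Finset X, Shatters Hc Y ∧ Y.card = d) →
        (∀ Y : Finset X, Shatters Hc Y → Y.card ≤ d) →
        ∀ m : ℕ, 1 ≤ m →
        ∃ A : (Fin m → X × Bool) → (X → Bool),
          (∀ S : Fin m → X × Bool,
            (∃ h ∈ Hc, ∀ i, h (S i).1 = (S i).2) →
            A S ∈ Hc ∧ ∀ i, (A S) (S i).1 = (S i).2) ∧
          ∀ h' ∈ Hc,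
            ent (fun g : X → Bool =>
                ∑ xs ∈ Finset.univ.filter
                  (fun xs : Fin m → X => A (fun i => (xs i, h' (xs i))) = g),
                  ∏ i, DX (xs i))
              ≤ C * d * Real.logb 2 ((m : ℝ) + 1) := by
  refine ⟨17, by norm_num, ?_⟩
  intro X _ _ DX hD hD1 Hc d hd _ hvc m hm
  obtain ⟨A, hA, hent⟩ := exists_consistent_learner hD hD1 hd hvc hm
  refine ⟨A, hA, fun h' hh' => ?_⟩
  convert hent h' hh'
end
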